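/- arXiv:2506.02042 — 4 statements merged into one kernel-verified Lean document; each statement's English description precedes it below -/
import Mathlib

section
/- Let N be a norm on the n×n complex matrices satisfying N(A ∘ B) ≤ N(A)·N(B) for all A, B ∈ M_n (Hadamard submultiplicativity). If X, Y ∈ M_n and at least one of X or Y is Hermitian, then ω_N(X ∘ Y) ≤ ω_N(X)·ω_N(Y). -/
open scoped ComplexOrder Matrix

/-- The Hermitian (real) part of a matrix: `Re(X) = (X + X*)/2`. -/
noncomputable def matRe {n : ℕ} (X : Matrix (Fin n) (Fin n) ℂ) :
    Matrix (Fin n) (Fin n) ℂ :=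
  (1 / 2 : ℂ) • (X + Xᴴ)

/-- The skew (imaginary) part of a matrix: `Im(X) = (X - X*)/(2i)`. -/
noncomputable def matIm {n : ℕ} (X : Matrix (Fin n) (Fin n) ℂ) :
    Matrix (Fin n) (Fin n) ℂ :=
  (1 / (2 * Complex.I)) • (X - Xᴴ)

/-- The generalized numerical radius induced by a norm `N`:
`ω_N(X) = sup_θ N(Re(e^{iθ} X))`. -/
noncomputable def gnr {n : ℕ} (N : Matrix (Fin n) (Fin n) ℂ → ℝ)
    (X : Matrix (Fin n) (Fin n) ℂ) : ℝ :=
  ⨆ θ : ℝ, N (matRe (Complex.exp (θ * Complex.I) • X))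

/-- The numerical range `W(X) = {⟨Xx, x⟩ : ‖x‖ = 1}` (standard inner product on ℂⁿ). -/
def numRange {n : ℕ} (X : Matrix (Fin n) (Fin n) ℂ) : Set ℂ :=
  { z | ∃ x : Fin n → ℂ, star x ⬝ᵥ x = 1 ∧ z = star x ⬝ᵥ X.mulVec x }

/-- The sector `S_α = {z : Re z > 0, |Im z| ≤ tan(α) Re z}`. -/
def sector (α : ℝ) : Set ℂ :=
  { z | 0 < z.re ∧ |z.im| ≤ Real.tan α * z.re }

/-- The class `M^s_{n,α}` of matrices `X` such that `W(zX) ⊆ S_α` for some unimodular `z`. -/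
def sectClass (n : ℕ) (α : ℝ) : Set (Matrix (Fin n) (Fin n) ℂ) :=
  { X | ∃ z : ℂ, ‖z‖ = 1 ∧ numRange (z • X) ⊆ sector α }

theorem gnr_aux_le {n : ℕ} (N : Matrix (Fin n) (Fin n) ℂ → ℝ)
    (hNs : ∀ (c : ℂ) (A : Matrix (Fin n) (Fin n) ℂ), N (c • A) = ‖c‖ * N A)
    (hNa : ∀ A B : Matrix (Fin n) (Fin n) ℂ, N (A + B) ≤ N A + N B)
    (X : Matrix (Fin n) (Fin n) ℂ) (θ : ℝ) :
    N (matRe (Complex.exp (θ * Complex.I) • X)) ≤ gnr N X := by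
  refine le_ciSup (f := fun θ : ℝ => N (matRe (Complex.exp (θ * Complex.I) • X)))
    ⟨1 / 2 * (N X + N Xᴴ), ?_⟩ θ
  rintro _ ⟨t, rfl⟩
  have h1 := hNa (Complex.exp (t * Complex.I) • X) (Complex.exp (t * Complex.I) • X)ᴴ
  rw [Matrix.conjTranspose_smul, hNs, hNs, norm_star, Complex.norm_exp_ofReal_mul_I] at h1
  simp only [matRe]
  rw [hNs, Matrix.conjTranspose_smul]
  have h2 : ‖(1 / 2 : ℂ)‖ = 1 / 2 := by norm_num
  rw [h2]
  linarith

theorem gnr_aux_herm {n : ℕ} (N : Matrix (Fin n) (Fin n) ℂ → ℝ)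
    (hN0 : ∀ A : Matrix (Fin n) (Fin n) ℂ, N A = 0 ↔ A = 0)
    (hNs : ∀ (c : ℂ) (A : Matrix (Fin n) (Fin n) ℂ), N (c • A) = ‖c‖ * N A)
    (hNa : ∀ A B : Matrix (Fin n) (Fin n) ℂ, N (A + B) ≤ N A + N B)
    (hHad : ∀ A B : Matrix (Fin n) (Fin n) ℂ, N (Matrix.hadamard A B) ≤ N A * N B)
    (X Y : Matrix (Fin n) (Fin n) ℂ) (h : X.IsHermitian) :
    gnr N (Matrix.hadamard X Y) ≤ gnr N X * gnr N Y := by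
  have hpos : ∀ A, 0 ≤ N A := by
    intro A
    have h1 := hNa A ((-1 : ℂ) • A)
    have h2 : A + (-1 : ℂ) • A = 0 := by simp
    rw [h2, (hN0 0).2 rfl, hNs] at h1
    norm_num at h1
    linarith
  have hX : N X ≤ gnr N X := by
    have h1 := gnr_aux_le N hNs hNa X 0
    have h2 : matRe (Complex.exp (((0 : ℝ) : ℂ) * Complex.I) • X) = X := by
      simp only [matRe, Complex.ofReal_zero, zero_mul, Complex.exp_zero, one_smul, h.eq]
      ext i j
      simp
      ring
    rwa [h2] at h1
  refine ciSup_le fun θ => ?_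
  have key : matRe (Complex.exp (θ * Complex.I) • Matrix.hadamard X Y)
      = Matrix.hadamard X (matRe (Complex.exp (θ * Complex.I) • Y)) := by
    ext i j
    have hij : star (X j i) = X i j := h.apply i j
    simp only [matRe, Matrix.smul_apply, Matrix.add_apply, Matrix.conjTranspose_apply,
      Matrix.hadamard_apply, smul_eq_mul, star_mul', hij]
    ring
  rw [key]
  exact (hHad _ _).trans (mul_le_mul hX (gnr_aux_le N hNs hNa Y θ) (hpos _)
    ((hpos _).trans hX))

theorem stmt_9 {n : ℕ} (N : Matrix (Fin n) (Fin n) ℂ → ℝ)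
    (hN0 : ∀ A : Matrix (Fin n) (Fin n) ℂ, N A = 0 ↔ A = 0)
    (hNs : ∀ (c : ℂ) (A : Matrix (Fin n) (Fin n) ℂ), N (c • A) = ‖c‖ * N A)
    (hNa : ∀ A B : Matrix (Fin n) (Fin n) ℂ, N (A + B) ≤ N A + N B)
    (hHad : ∀ A B : Matrix (Fin n) (Fin n) ℂ, N (Matrix.hadamard A B) ≤ N A * N B)
    (X Y : Matrix (Fin n) (Fin n) ℂ) (h : X.IsHermitian ∨ Y.IsHermitian) :
    gnr N (Matrix.hadamard X Y) ≤ gnr N X * gnr N Y := by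
  rcases h with h | h
  · exact gnr_aux_herm N hN0 hNs hNa hHad X Y h
  · rw [Matrix.hadamard_comm, mul_comm]
    exact gnr_aux_herm N hN0 hNs hNa hHad Y X h
end

section
/- Let N be a submultiplicative, unitarily invariant norm on the n×n complex matrices and let α ∈ [0, π/2). If X, Y ∈ M^s_{n,α}, then ω_N(X ∘ Y) ≤ sec²(α)·ω_N(X)·ω_N(Y). -/
open scoped ComplexOrder Matrix

section Helpers

open Matrix

variable {n : ℕ}

lemma exists_diagonalization {A : Matrix (Fin n) (Fin n) ℂ} (hA : A.IsHermitian) :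
    ∃ U ∈ Matrix.unitaryGroup (Fin n) ℂ, ∃ d : Fin n → ℝ,
      A = U * Matrix.diagonal (fun i => (d i : ℂ)) * Uᴴ := by
  refine ⟨hA.eigenvectorUnitary, hA.eigenvectorUnitary.2, hA.eigenvalues, ?_⟩
  have h := hA.spectral_theorem
  rw [Unitary.conjStarAlgAut_apply] at h
  exact h

lemma diag_unitary (d : Fin n → ℂ) (hd : ∀ i, ‖d i‖ = 1) :
    Matrix.diagonal d ∈ Matrix.unitaryGroup (Fin n) ℂ := by
  rw [Matrix.mem_unitaryGroup_iff, Matrix.star_eq_conjTranspose, Matrix.diagonal_conjTranspose,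
    Matrix.diagonal_mul_diagonal, ← Matrix.diagonal_one]
  congr 1
  ext i
  have := Complex.mul_conj' (d i)
  simp only [Pi.star_apply, RCLike.star_def]
  rw [this, hd i]; simp

lemma psd_congr {A B : Matrix (Fin n) (Fin n) ℂ} (h : A.PosSemidef) (e : B = A) :
    B.PosSemidef := e ▸ h

lemma pinch (N : Matrix (Fin n) (Fin n) ℂ → ℝ)
    (hNs : ∀ (c : ℂ) (A : Matrix (Fin n) (Fin n) ℂ), N (c • A) = ‖c‖ * N A)
    (hNa : ∀ A B : Matrix (Fin n) (Fin n) ℂ, N (A + B) ≤ N A + N B)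
    (hUI : ∀ U V A : Matrix (Fin n) (Fin n) ℂ, U ∈ Matrix.unitaryGroup (Fin n) ℂ →
      V ∈ Matrix.unitaryGroup (Fin n) ℂ → N (U * A * V) = N A)
    (M : Matrix (Fin n) (Fin n) ℂ) :
    N (Matrix.diagonal (fun i => M i i)) ≤ N M := by
  have key : ∀ S : Finset (Fin n),
      N (Matrix.of fun i j => if i ≠ j ∧ (i ∈ S ∨ j ∈ S) then 0 else M i j) ≤ N M := by
    intro S
    induction S using Finset.induction_on with
    | empty => 
      apply le_of_eq
      congr 1
      ext i j
      simp
    | insert k S hk ih =>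
      refine le_trans ?_ ih
      set P : Matrix (Fin n) (Fin n) ℂ :=
        Matrix.of fun i j => if i ≠ j ∧ (i ∈ S ∨ j ∈ S) then 0 else M i j with hP
      set D : Matrix (Fin n) (Fin n) ℂ :=
        Matrix.diagonal (fun i => if i = k then -1 else 1) with hD
      have hDu : D ∈ Matrix.unitaryGroup (Fin n) ℂ := by
        apply diag_unitary
        intro i
        split_ifs <;> simp
      have heq : (Matrix.of fun i j =>
          if i ≠ j ∧ (i ∈ insert k S ∨ j ∈ insert k S) then 0 else M i j) =
          (1 / 2 : ℂ) • (P + D * P * D) := by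
        ext i j
        rw [hD, Matrix.smul_apply, Matrix.add_apply, Matrix.mul_diagonal, Matrix.diagonal_mul, hP]
        simp only [Matrix.of_apply, Finset.mem_insert, smul_eq_mul]
        by_cases hij : i = j
        · subst hij
          by_cases hi : i = k <;> simp [hi] <;> ring
        · by_cases hi : i = k
          · have hj : ¬ j = k := fun h => hij (hi.trans h.symm)
            simp [hi, hj, hij]
            grind
          · by_cases hj : j = k
            · simp [hi, hj]
            · simp only [hi, hj, hij, false_or, if_false]
              ring
      rw [heq, hNs]
      have h1 := hNa P (D * P * D)
      rw [hUI D D P hDu hDu] at h1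
      have : ‖(1 / 2 : ℂ)‖ = 1 / 2 := by norm_num
      rw [this]
      linarith
  have h := key Finset.univ
  convert h using 2
  ext i j
  by_cases hij : i = j
  · subst hij; simp
  · simp [hij]

lemma diag_contr (N : Matrix (Fin n) (Fin n) ℂ → ℝ)
    (hNs : ∀ (c : ℂ) (A : Matrix (Fin n) (Fin n) ℂ), N (c • A) = ‖c‖ * N A)
    (hNa : ∀ A B : Matrix (Fin n) (Fin n) ℂ, N (A + B) ≤ N A + N B)
    (hUI : ∀ U V A : Matrix (Fin n) (Fin n) ℂ, U ∈ Matrix.unitaryGroup (Fin n) ℂ →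
      V ∈ Matrix.unitaryGroup (Fin n) ℂ → N (U * A * V) = N A)
    (h p : Fin n → ℝ) (hp : ∀ i, |h i| ≤ p i) :
    N (Matrix.diagonal (fun i => (h i : ℂ))) ≤ N (Matrix.diagonal (fun i => (p i : ℂ))) := by
  have hex : ∀ i, ∃ u : ℂ, ‖u‖ = 1 ∧ (h i : ℂ) = (1 / 2 : ℂ) * (u * p i + star u * p i) := by
    intro i
    obtain ⟨t, ht, hti⟩ : ∃ t : ℝ, |t| ≤ 1 ∧ h i = t * p i := by
      by_cases h0 : p i = 0
      · refine ⟨0, by simp, ?_⟩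
        have := hp i
        rw [h0] at this
        rw [abs_nonpos_iff.mp this]; simp
      · have hpos : 0 < p i := lt_of_le_of_ne ((abs_nonneg _).trans (hp i)) (Ne.symm h0)
        refine ⟨h i / p i, ?_, by field_simp⟩
        rw [abs_div, abs_of_pos hpos, div_le_one hpos]
        exact hp i
    have ht2 : t ^ 2 ≤ 1 := (sq_le_one_iff_abs_le_one t).2 ht
    refine ⟨⟨t, Real.sqrt (1 - t ^ 2)⟩, ?_, ?_⟩
    · have hn := Complex.sq_norm (⟨t, Real.sqrt (1 - t ^ 2)⟩ : ℂ)
      rw [Complex.normSq_apply] at hn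
      simp only at hn
      rw [Real.mul_self_sqrt (by linarith)] at hn
      have h1 : ‖(⟨t, Real.sqrt (1 - t ^ 2)⟩ : ℂ)‖ ^ 2 = 1 := by rw [hn]; ring
      exact (pow_eq_one_iff_of_nonneg (norm_nonneg _) two_ne_zero).1 h1
    · apply Complex.ext
      · simp [hti]; ring
      · simp
  choose u hu hh using hex
  have heq : Matrix.diagonal (fun i => (h i : ℂ)) = (1 / 2 : ℂ) •
      (Matrix.diagonal u * Matrix.diagonal (fun i => (p i : ℂ)) * 1 +
       Matrix.diagonal (fun i => star (u i)) * Matrix.diagonal (fun i => (p i : ℂ)) * 1) := by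
    rw [mul_one, mul_one, Matrix.diagonal_mul_diagonal, Matrix.diagonal_mul_diagonal,
      Matrix.diagonal_add, ← Matrix.diagonal_smul]
    congr 1
    ext i
    exact hh i
  rw [heq, hNs]
  refine (mul_le_mul_of_nonneg_left (hNa _ _) (norm_nonneg _)).trans ?_
  rw [hUI _ _ _ (diag_unitary u hu) (one_mem _),
    hUI _ _ _ (diag_unitary _ (fun i => by rw [norm_star]; exact hu i)) (one_mem _)]
  have : ‖(1 / 2 : ℂ)‖ = 1 / 2 := by norm_num
  rw [this]
  linarith

lemma N_mono (N : Matrix (Fin n) (Fin n) ℂ → ℝ)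
    (hNs : ∀ (c : ℂ) (A : Matrix (Fin n) (Fin n) ℂ), N (c • A) = ‖c‖ * N A)
    (hNa : ∀ A B : Matrix (Fin n) (Fin n) ℂ, N (A + B) ≤ N A + N B)
    (hUI : ∀ U V A : Matrix (Fin n) (Fin n) ℂ, U ∈ Matrix.unitaryGroup (Fin n) ℂ →
      V ∈ Matrix.unitaryGroup (Fin n) ℂ → N (U * A * V) = N A)
    (H P : Matrix (Fin n) (Fin n) ℂ) (hH : H.IsHermitian)
    (h1 : (P - H).PosSemidef) (h2 : (P + H).PosSemidef) : N H ≤ N P := by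
  obtain ⟨U, hU, d, rfl⟩ := exists_diagonalization hH
  have hU' : Uᴴ ∈ Matrix.unitaryGroup (Fin n) ℂ := by
    rw [← Matrix.star_eq_conjTranspose]; exact Unitary.star_mem hU
  have hUU : Uᴴ * U = 1 := by
    rw [← Matrix.star_eq_conjTranspose]; exact Matrix.mem_unitaryGroup_iff'.1 hU
  set D := Matrix.diagonal (fun i => (d i : ℂ)) with hD
  have e : Uᴴ * (U * D * Uᴴ) * U = D := by
    have : Uᴴ * (U * D * Uᴴ) * U = (Uᴴ * U) * D * (Uᴴ * U) := by simp only [mul_assoc]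
    rw [this, hUU]; simp
  have k1 := h1.conjTranspose_mul_mul_same U
  have k2 := h2.conjTranspose_mul_mul_same U
  rw [mul_sub, sub_mul, e] at k1
  rw [mul_add, add_mul, e] at k2
  rw [hUI U Uᴴ D hU hU', ← hUI Uᴴ U P hU' hU]
  set Q := Uᴴ * P * U with hQ
  have hb : ∀ i, |d i| ≤ (Q i i).re ∧ (Q i i).im = 0 := by
    intro i
    have a1 := k1.diag_nonneg (i := i)
    have a2 := k2.diag_nonneg (i := i)
    rw [Complex.le_def] at a1 a2
    simp [hD] at a1 a2
    refine ⟨abs_le.2 ⟨by linarith, by linarith⟩, a1.2.symm⟩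
  refine le_trans (diag_contr N hNs hNa hUI d (fun i => (Q i i).re) (fun i => (hb i).1)) ?_
  refine le_trans (le_of_eq ?_) (pinch N hNs hNa hUI Q)
  congr 2
  ext i
  apply Complex.ext
  · simp
  · simp [(hb i).2]

lemma N_nonneg (N : Matrix (Fin n) (Fin n) ℂ → ℝ)
    (hNs : ∀ (c : ℂ) (A : Matrix (Fin n) (Fin n) ℂ), N (c • A) = ‖c‖ * N A)
    (hNa : ∀ A B : Matrix (Fin n) (Fin n) ℂ, N (A + B) ≤ N A + N B)
    (A : Matrix (Fin n) (Fin n) ℂ) : 0 ≤ N A := by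
  have h := hNa A ((-1 : ℂ) • A)
  have h0 := hNs 0 A
  rw [hNs] at h
  simp at h h0
  linarith

lemma N_sub_psd (N : Matrix (Fin n) (Fin n) ℂ → ℝ)
    (hN0 : ∀ A : Matrix (Fin n) (Fin n) ℂ, N A = 0 ↔ A = 0)
    (hNs : ∀ (c : ℂ) (A : Matrix (Fin n) (Fin n) ℂ), N (c • A) = ‖c‖ * N A)
    (hNa : ∀ A B : Matrix (Fin n) (Fin n) ℂ, N (A + B) ≤ N A + N B)
    (hUI : ∀ U V A : Matrix (Fin n) (Fin n) ℂ, U ∈ Matrix.unitaryGroup (Fin n) ℂ →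
      V ∈ Matrix.unitaryGroup (Fin n) ℂ → N (U * A * V) = N A)
    (hSM : ∀ A B : Matrix (Fin n) (Fin n) ℂ, N (A * B) ≤ N A * N B)
    (A : Matrix (Fin n) (Fin n) ℂ) (hA : A.IsHermitian) :
    ((N A : ℂ) • (1 : Matrix (Fin n) (Fin n) ℂ) - A).PosSemidef := by
  obtain ⟨U, hU, d, hAe⟩ := exists_diagonalization hA
  have hU' : Uᴴ ∈ Matrix.unitaryGroup (Fin n) ℂ := by
    rw [← Matrix.star_eq_conjTranspose]; exact Unitary.star_mem hU
  have hUU : U * Uᴴ = 1 := by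
    rw [← Matrix.star_eq_conjTranspose]; exact Matrix.mem_unitaryGroup_iff.1 hU
  set D := Matrix.diagonal (fun i => (d i : ℂ)) with hD
  have hNA : N A = N D := by rw [hAe, hUI U Uᴴ D hU hU']
  have hd : ∀ i, d i ≤ N A := by
    intro i
    set E : Matrix (Fin n) (Fin n) ℂ := Matrix.single i i 1 with hE
    have hDE : D * E = (d i : ℂ) • E := by
      ext a b
      rw [hD, Matrix.diagonal_mul, Matrix.smul_apply, hE]
      by_cases h : i = a
      · subst h; simp
      · simp [Matrix.single_apply, h]
    have hE0 : E ≠ 0 := by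
      intro h
      have := congrFun (congrFun h i) i
      simp [hE] at this
    have hpos : 0 < N E :=
      lt_of_le_of_ne (N_nonneg N hNs hNa E) (fun h => hE0 ((hN0 E).1 h.symm))
    have h := hSM D E
    rw [hDE, hNs, ← hNA] at h
    have := le_of_mul_le_mul_right h hpos
    rw [Complex.norm_real] at this
    exact (le_abs_self _).trans this
  have : (N A : ℂ) • (1 : Matrix (Fin n) (Fin n) ℂ) - A =
      U * Matrix.diagonal (fun i => (N A : ℂ) - d i) * Uᴴ := by
    have e : Matrix.diagonal (fun i => (N A : ℂ) - d i) =
        (N A : ℂ) • (1 : Matrix (Fin n) (Fin n) ℂ) - D := by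
      rw [hD, ← Matrix.diagonal_one, ← Matrix.diagonal_smul, Matrix.diagonal_sub]
      congr 1
      ext i; simp
    rw [e, mul_sub, sub_mul, ← hAe]
    simp [hUU]
  rw [this]
  apply Matrix.PosSemidef.mul_mul_conjTranspose_same
  apply Matrix.PosSemidef.diagonal
  intro i
  have := hd i
  simp only [Pi.zero_apply]
  rw [← Complex.ofReal_sub]
  exact_mod_cast sub_nonneg.2 this

lemma matRe_herm (X : Matrix (Fin n) (Fin n) ℂ) : (matRe X).IsHermitian := by
  unfold matRe Matrix.IsHermitian
  rw [Matrix.conjTranspose_smul, Matrix.conjTranspose_add, Matrix.conjTranspose_conjTranspose,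
    add_comm]
  simp

lemma matIm_herm (X : Matrix (Fin n) (Fin n) ℂ) : (matIm X).IsHermitian := by
  unfold matIm Matrix.IsHermitian
  rw [Matrix.conjTranspose_smul, Matrix.conjTranspose_sub, Matrix.conjTranspose_conjTranspose]
  ext i j
  simp
  ring

lemma quad_conj (X : Matrix (Fin n) (Fin n) ℂ) (x : Fin n → ℂ) :
    star x ⬝ᵥ (Xᴴ *ᵥ x) = star (star x ⬝ᵥ (X *ᵥ x)) := by
  rw [Matrix.star_dotProduct, Matrix.star_mulVec, Matrix.conjTranspose_conjTranspose,
    Matrix.dotProduct_mulVec]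

lemma quad_re (X : Matrix (Fin n) (Fin n) ℂ) (x : Fin n → ℂ) :
    star x ⬝ᵥ (matRe X *ᵥ x) = ((star x ⬝ᵥ (X *ᵥ x)).re : ℂ) := by
  unfold matRe
  rw [Matrix.smul_mulVec, Matrix.add_mulVec, dotProduct_smul, dotProduct_add, quad_conj]
  generalize star x ⬝ᵥ (X *ᵥ x) = z
  apply Complex.ext
  · simp; ring
  · simp

lemma quad_im (X : Matrix (Fin n) (Fin n) ℂ) (x : Fin n → ℂ) :
    star x ⬝ᵥ (matIm X *ᵥ x) = ((star x ⬝ᵥ (X *ᵥ x)).im : ℂ) := by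
  unfold matIm
  rw [Matrix.smul_mulVec, Matrix.sub_mulVec, dotProduct_smul, dotProduct_sub, quad_conj]
  generalize star x ⬝ᵥ (X *ᵥ x) = z
  apply Complex.ext <;> simp <;> ring

lemma sector_quad {α : ℝ} {X : Matrix (Fin n) (Fin n) ℂ} (hX : numRange X ⊆ sector α)
    (x : Fin n → ℂ) : 0 ≤ (star x ⬝ᵥ (X *ᵥ x)).re ∧
      |(star x ⬝ᵥ (X *ᵥ x)).im| ≤ Real.tan α * (star x ⬝ᵥ (X *ᵥ x)).re := by
  by_cases hx : x = 0
  · subst hx; simp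
  · have hpos : 0 < star x ⬝ᵥ x := Matrix.dotProduct_star_self_pos_iff.2 hx
    rw [Complex.lt_def] at hpos
    obtain ⟨hr, him⟩ := hpos
    set r := (star x ⬝ᵥ x).re with hrdef
    have hrr : star x ⬝ᵥ x = (r : ℂ) := by
      apply Complex.ext
      · simp [hrdef]
      · simpa using him.symm
    simp only [Complex.zero_re] at hr
    set s : ℝ := (Real.sqrt r)⁻¹ with hs
    have hss : s * s = r⁻¹ := by
      rw [hs, ← mul_inv, Real.mul_self_sqrt hr.le]
    have hssc : (s : ℂ) * s = (r : ℂ)⁻¹ := by exact_mod_cast hss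
    have hmem := hX (show star x ⬝ᵥ (X *ᵥ x) * (r : ℂ)⁻¹ ∈ numRange X from ?_)
    · obtain ⟨h1, h2⟩ := hmem
      rw [← Complex.ofReal_inv] at h1 h2
      rw [Complex.re_mul_ofReal] at h1 h2
      rw [Complex.im_mul_ofReal, abs_mul, abs_of_pos (inv_pos.2 hr), ← mul_assoc] at h2
      exact ⟨(pos_of_mul_pos_left h1 (inv_pos.2 hr).le).le,
        le_of_mul_le_mul_right h2 (inv_pos.2 hr)⟩
    · refine ⟨(s : ℂ) • x, ?_, ?_⟩
      · rw [star_smul, smul_dotProduct, dotProduct_smul, hrr]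
        simp only [smul_eq_mul, RCLike.star_def, Complex.conj_ofReal]
        rw [← mul_assoc, hssc]
        have : (r : ℂ) ≠ 0 := by exact_mod_cast hr.ne'
        field_simp
      · rw [star_smul, smul_dotProduct, Matrix.mulVec_smul, dotProduct_smul]
        simp only [smul_eq_mul, RCLike.star_def, Complex.conj_ofReal]
        rw [← mul_assoc, hssc, mul_comm]

lemma re_psd {α : ℝ} {X : Matrix (Fin n) (Fin n) ℂ} (hX : numRange X ⊆ sector α) :
    (matRe X).PosSemidef := by
  refine .of_dotProduct_mulVec_nonneg (matRe_herm X) fun x => ?_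
  rw [quad_re]
  exact_mod_cast (sector_quad hX x).1

lemma pm_psd {α : ℝ} {X : Matrix (Fin n) (Fin n) ℂ} (hX : numRange X ⊆ sector α)
    (e : ℝ) (he : |e| = 1) :
    ((Real.tan α : ℂ) • matRe X + (e : ℂ) • matIm X).PosSemidef := by
  refine .of_dotProduct_mulVec_nonneg ?_ fun x => ?_
  · unfold Matrix.IsHermitian
    rw [Matrix.conjTranspose_add, Matrix.conjTranspose_smul, Matrix.conjTranspose_smul,
      matRe_herm, matIm_herm]
    simp only [RCLike.star_def, Complex.conj_ofReal]
  · rw [Matrix.add_mulVec, Matrix.smul_mulVec, Matrix.smul_mulVec, dotProduct_add,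
      dotProduct_smul, dotProduct_smul, quad_re, quad_im]
    have h := (sector_quad hX x).2
    simp only [smul_eq_mul]
    have h3 : -(e * (star x ⬝ᵥ (X *ᵥ x)).im) ≤ |(star x ⬝ᵥ (X *ᵥ x)).im| := by
      refine (neg_le_abs _).trans ?_
      rw [abs_mul, he, one_mul]
    have : 0 ≤ Real.tan α * (star x ⬝ᵥ (X *ᵥ x)).re + e * (star x ⬝ᵥ (X *ᵥ x)).im := by linarith
    exact_mod_cast this

lemma re_had_expand (X Y : Matrix (Fin n) (Fin n) ℂ) (p q : ℝ) :
    matRe ((⟨p, q⟩ : ℂ) • (X ⊙ Y)) =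
      (p : ℂ) • (matRe X ⊙ matRe Y - matIm X ⊙ matIm Y) -
      (q : ℂ) • (matRe X ⊙ matIm Y + matIm X ⊙ matRe Y) := by
  ext i j
  simp only [matRe, matIm, Matrix.smul_apply, Matrix.add_apply, Matrix.sub_apply,
    Matrix.hadamard_apply, Matrix.conjTranspose_apply, smul_eq_mul, RCLike.star_def, map_mul]
  generalize X i j = a
  generalize Y i j = b
  generalize X j i = c
  generalize Y j i = d
  apply Complex.ext <;> simp <;> ring

lemma key_psd {α : ℝ} (ht0 : 0 ≤ Real.tan α) {X Y : Matrix (Fin n) (Fin n) ℂ}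
    (hX : numRange X ⊆ sector α) (hY : numRange Y ⊆ sector α) (p q : ℝ) (hpq : p ^ 2 + q ^ 2 = 1) :
    (((1 + Real.tan α ^ 2 : ℝ) : ℂ) • (matRe X ⊙ matRe Y) -
      matRe ((⟨p, q⟩ : ℂ) • (X ⊙ Y))).PosSemidef := by
  have a0 := (re_psd hX).hadamard (re_psd hY)
  have x1 := pm_psd hX 1 (by simp)
  have x2 := pm_psd hX (-1) (by simp)
  have y1 := pm_psd hY 1 (by simp)
  have y2 := pm_psd hY (-1) (by simp)
  have hp1 : p ≤ 1 := by nlinarith [sq_nonneg q]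
  rw [re_had_expand]
  set A := matRe X
  set B := matIm X
  set C := matRe Y
  set D := matIm Y
  set t := Real.tan α
  rcases ht0.eq_or_lt with h0 | ht
  · have hz : ∀ M : Matrix (Fin n) (Fin n) ℂ, M.PosSemidef → (-M).PosSemidef → M = 0 := by
      intro M h1 h2
      open scoped MatrixOrder in
      exact le_antisymm (show (0 - M).PosSemidef by simpa using h2)
        (show (M - 0).PosSemidef by simpa using h1)
    have hB : B = 0 := hz B (by simpa [← h0] using x1) (by simpa [← h0] using x2)
    have hD : D = 0 := hz D (by simpa [← h0] using y1) (by simpa [← h0] using y2)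
    have := a0.smul (a := ((1 - p : ℝ) : ℂ)) (by exact_mod_cast sub_nonneg.2 hp1)
    refine psd_congr this ?_
    rw [hB, hD, ← h0]
    simp [sub_smul]
  · have c1 : 0 ≤ (1 + t ^ 2 - (p * (1 - t ^ 2) - q * (2 * t))) / (4 * t ^ 2) := by
      apply div_nonneg _ (by positivity)
      have : (p * (1 - t ^ 2) - q * (2 * t)) ^ 2 ≤ (1 + t ^ 2) ^ 2 := by
        have : (1 + t ^ 2) ^ 2 = (p ^ 2 + q ^ 2) * (1 + t ^ 2) ^ 2 := by rw [hpq]; ring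
        rw [this]
        nlinarith [sq_nonneg (p * (2 * t) + q * (1 - t ^ 2))]
      linarith [abs_le_of_sq_le_sq' this (by positivity)]
    have c2 : 0 ≤ (1 + t ^ 2 - (p * (1 - t ^ 2) + q * (2 * t))) / (4 * t ^ 2) := by
      apply div_nonneg _ (by positivity)
      have : (p * (1 - t ^ 2) + q * (2 * t)) ^ 2 ≤ (1 + t ^ 2) ^ 2 := by
        have : (1 + t ^ 2) ^ 2 = (p ^ 2 + q ^ 2) * (1 + t ^ 2) ^ 2 := by rw [hpq]; ring
        rw [this]
        nlinarith [sq_nonneg (p * (2 * t) - q * (1 - t ^ 2))]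
      linarith [(abs_le_of_sq_le_sq' this (by positivity)).2]
    have c3 : 0 ≤ (1 + t ^ 2 - p * (1 + t ^ 2)) / (4 * t ^ 2) := by
      apply div_nonneg _ (by positivity)
      nlinarith [sq_nonneg t]
    have z1 := (x1.hadamard y1).smul (Complex.zero_le_real.2 c1)
    have z2 := (x2.hadamard y2).smul (Complex.zero_le_real.2 c2)
    have z3 := ((x1.hadamard y2).add (x2.hadamard y1)).smul (Complex.zero_le_real.2 c3)
    refine psd_congr ((z1.add z2).add z3) ?_
    ext i j
    simp only [Matrix.smul_apply, Matrix.add_apply, Matrix.sub_apply, Matrix.hadamard_apply,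
      smul_eq_mul]
    have : (t : ℂ) ≠ 0 := by exact_mod_cast ht.ne'
    push_cast
    field_simp
    ring

lemma main_bound (N : Matrix (Fin n) (Fin n) ℂ → ℝ)
    (hN0 : ∀ A : Matrix (Fin n) (Fin n) ℂ, N A = 0 ↔ A = 0)
    (hNs : ∀ (c : ℂ) (A : Matrix (Fin n) (Fin n) ℂ), N (c • A) = ‖c‖ * N A)
    (hNa : ∀ A B : Matrix (Fin n) (Fin n) ℂ, N (A + B) ≤ N A + N B)
    (hUI : ∀ U V A : Matrix (Fin n) (Fin n) ℂ, U ∈ Matrix.unitaryGroup (Fin n) ℂ →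
      V ∈ Matrix.unitaryGroup (Fin n) ℂ → N (U * A * V) = N A)
    (hSM : ∀ A B : Matrix (Fin n) (Fin n) ℂ, N (A * B) ≤ N A * N B)
    {α : ℝ} (ht0 : 0 ≤ Real.tan α) {X Y : Matrix (Fin n) (Fin n) ℂ}
    (hX : numRange X ⊆ sector α) (hY : numRange Y ⊆ sector α) (c : ℂ) (hc : ‖c‖ = 1) :
    N (matRe (c • (X ⊙ Y))) ≤ (1 + Real.tan α ^ 2) * (N (matRe X) * N (matRe Y)) := by
  have hc2 : c.re ^ 2 + c.im ^ 2 = 1 := by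
    have := Complex.sq_norm c
    rw [hc, Complex.normSq_apply] at this
    nlinarith
  have k1 := key_psd ht0 hX hY c.re c.im hc2
  have k2 := key_psd ht0 hX hY (-c.re) (-c.im) (by rw [neg_sq, neg_sq]; exact hc2)
  have e1 : (⟨c.re, c.im⟩ : ℂ) = c := rfl
  have e2 : (⟨-c.re, -c.im⟩ : ℂ) = -c := by apply Complex.ext <;> simp
  have e3 : matRe (-c • (X ⊙ Y)) = - matRe (c • (X ⊙ Y)) := by
    unfold matRe
    rw [neg_smul, Matrix.conjTranspose_neg, ← neg_add, smul_neg]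
  rw [e1] at k1
  rw [e2, e3, sub_neg_eq_add] at k2
  set H := matRe (c • (X ⊙ Y)) with hH
  set s : ℝ := 1 + Real.tan α ^ 2 with hs
  have hs0 : 0 ≤ s := by positivity
  set A := matRe X with hA
  set C := matRe Y with hC
  have hd := ((N_sub_psd N hN0 hNs hNa hUI hSM A (matRe_herm X)).hadamard (re_psd hY)).smul
    (Complex.zero_le_real.2 hs0)
  set P : Matrix (Fin n) (Fin n) ℂ := ((s * N A : ℝ) : ℂ) • Matrix.diagonal (fun i => C i i) with hP
  have heq : (s : ℂ) • (((N A : ℂ) • (1 : Matrix (Fin n) (Fin n) ℂ) - A) ⊙ C) =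
      P - (s : ℂ) • (A ⊙ C) := by
    ext i j
    simp only [hP, Matrix.smul_apply, Matrix.sub_apply, Matrix.hadamard_apply, smul_eq_mul]
    by_cases hij : i = j
    · subst hij; simp; ring
    · simp [hij]
  rw [← hC, heq] at hd
  have h1 : (P - H).PosSemidef := by
    refine psd_congr (hd.add k1) ?_; abel
  have h2 : (P + H).PosSemidef := by
    refine psd_congr (hd.add k2) ?_; abel
  have hNA := N_nonneg N hNs hNa A
  calc N H ≤ N P := N_mono N hNs hNa hUI H P (matRe_herm _) h1 h2
    _ = (s * N A) * N (Matrix.diagonal (fun i => C i i)) := by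
        rw [hP, hNs, Complex.norm_real, Real.norm_of_nonneg (by positivity)]
    _ ≤ (s * N A) * N C := mul_le_mul_of_nonneg_left (pinch N hNs hNa hUI C) (by positivity)
    _ = _ := by ring

lemma le_gnr (N : Matrix (Fin n) (Fin n) ℂ → ℝ)
    (hNs : ∀ (c : ℂ) (A : Matrix (Fin n) (Fin n) ℂ), N (c • A) = ‖c‖ * N A)
    (hNa : ∀ A B : Matrix (Fin n) (Fin n) ℂ, N (A + B) ≤ N A + N B)
    (X : Matrix (Fin n) (Fin n) ℂ) (z : ℂ) (hz : ‖z‖ = 1) :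
    N (matRe (z • X)) ≤ gnr N X := by
  have hb : BddAbove (Set.range fun θ : ℝ => N (matRe (Complex.exp (θ * Complex.I) • X))) := by
    refine ⟨‖(1 / 2 : ℂ)‖ * (N X + N Xᴴ), ?_⟩
    rintro _ ⟨θ, rfl⟩
    simp only [matRe]
    rw [hNs]
    refine mul_le_mul_of_nonneg_left ((hNa _ _).trans ?_) (norm_nonneg _)
    rw [Matrix.conjTranspose_smul, hNs, hNs, norm_star, Complex.norm_exp_ofReal_mul_I]
    simp
  have h := le_ciSup hb z.arg
  have hz' : Complex.exp (z.arg * Complex.I) = z := by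
    have := Complex.norm_mul_exp_arg_mul_I z
    rw [hz] at this
    simpa using this
  simp only [hz'] at h
  exact h

end Helpers

theorem stmt_11 {n : ℕ} (N : Matrix (Fin n) (Fin n) ℂ → ℝ)
    (hN0 : ∀ A : Matrix (Fin n) (Fin n) ℂ, N A = 0 ↔ A = 0)
    (hNs : ∀ (c : ℂ) (A : Matrix (Fin n) (Fin n) ℂ), N (c • A) = ‖c‖ * N A)
    (hNa : ∀ A B : Matrix (Fin n) (Fin n) ℂ, N (A + B) ≤ N A + N B)
    (hUI : ∀ U V A : Matrix (Fin n) (Fin n) ℂ, U ∈ Matrix.unitaryGroup (Fin n) ℂ →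
      V ∈ Matrix.unitaryGroup (Fin n) ℂ → N (U * A * V) = N A)
    (hSM : ∀ A B : Matrix (Fin n) (Fin n) ℂ, N (A * B) ≤ N A * N B)
    {α : ℝ} (hα0 : 0 ≤ α) (hα1 : α < Real.pi / 2)
    (X Y : Matrix (Fin n) (Fin n) ℂ)
    (hX : X ∈ sectClass n α) (hY : Y ∈ sectClass n α) :
    gnr N (Matrix.hadamard X Y) ≤ ((Real.cos α)⁻¹) ^ 2 * gnr N X * gnr N Y := by
  obtain ⟨z, hz, hXz⟩ := hX
  obtain ⟨w, hw, hYw⟩ := hY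
  have hcos : 0 < Real.cos α := Real.cos_pos_of_mem_Ioo ⟨by linarith [Real.pi_pos], hα1⟩
  have ht0 : 0 ≤ Real.tan α := Real.tan_nonneg_of_nonneg_of_le_pi_div_two hα0 hα1.le
  have hsec : ((Real.cos α)⁻¹) ^ 2 = 1 + Real.tan α ^ 2 := by
    rw [Real.tan_eq_sin_div_cos]
    field_simp
    rw [add_comm, Real.sin_sq_add_cos_sq]
  rw [hsec]
  unfold gnr
  refine ciSup_le fun θ => ?_
  have hz0 : z ≠ 0 := by intro h; simp [h] at hz
  have hw0 : w ≠ 0 := by intro h; simp [h] at hw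
  have he : Complex.exp (θ * Complex.I) • (Matrix.hadamard X Y) =
      (Complex.exp (θ * Complex.I) * z⁻¹ * w⁻¹) • (Matrix.hadamard (z • X) (w • Y)) := by
    ext i j
    simp only [Matrix.smul_apply, Matrix.hadamard_apply, smul_eq_mul]
    field_simp
  rw [he]
  refine (main_bound N hN0 hNs hNa hUI hSM ht0 hXz hYw _ ?_).trans ?_
  · rw [norm_mul, norm_mul, norm_inv, norm_inv, hz, hw, Complex.norm_exp_ofReal_mul_I]; simp
  · rw [mul_assoc]
    refine mul_le_mul_of_nonneg_left ?_ (by positivity)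
    have h1 := le_gnr N hNs hNa X z hz
    have h2 := le_gnr N hNs hNa Y w hw
    exact mul_le_mul h1 h2 (N_nonneg N hNs hNa _) ((N_nonneg N hNs hNa _).trans h1)
end

section
/- Let N be a submultiplicative, unitarily invariant norm on the n×n complex matrices and let m ≥ 1. If X₁, …, X_m ∈ M_n are all accretive-dissipative, then ω_N(X₁ ∘ X₂ ∘ ⋯ ∘ X_m) ≤ 2^{m/2}·ω_N(X₁)·ω_N(X₂)⋯ω_N(X_m). -/
open scoped ComplexOrder Matrix

open Matrix in
theorem aux_nonneg {n : ℕ} {N : Matrix (Fin n) (Fin n) ℂ → ℝ}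
    (hN0 : ∀ A : Matrix (Fin n) (Fin n) ℂ, N A = 0 ↔ A = 0)
    (hNs : ∀ (c : ℂ) (A : Matrix (Fin n) (Fin n) ℂ), N (c • A) = ‖c‖ * N A)
    (hNa : ∀ A B : Matrix (Fin n) (Fin n) ℂ, N (A + B) ≤ N A + N B)
    (A : Matrix (Fin n) (Fin n) ℂ) : 0 ≤ N A := by
  have h1 := hNa A ((-1 : ℂ) • A)
  rw [hNs] at h1
  have h2 : A + (-1 : ℂ) • A = 0 := by simp
  rw [h2, (hN0 0).2 rfl] at h1
  simp at h1
  linarith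

/-- sign flip matrix -/
noncomputable def auxD {n : ℕ} (k : Fin n) : Matrix (Fin n) (Fin n) ℂ :=
  Matrix.diagonal fun i => if i = k then -1 else 1

theorem auxD_mem {n : ℕ} (k : Fin n) : auxD k ∈ Matrix.unitaryGroup (Fin n) ℂ := by
  rw [Matrix.mem_unitaryGroup_iff, Matrix.star_eq_conjTranspose, auxD,
    Matrix.diagonal_conjTranspose, Matrix.diagonal_mul_diagonal, ← Matrix.diagonal_one]
  congr 1
  funext i
  by_cases h : i = k <;> simp [h]

open Matrix in
theorem aux_pinch {n : ℕ} {N : Matrix (Fin n) (Fin n) ℂ → ℝ}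
    (hNs : ∀ (c : ℂ) (A : Matrix (Fin n) (Fin n) ℂ), N (c • A) = ‖c‖ * N A)
    (hNa : ∀ A B : Matrix (Fin n) (Fin n) ℂ, N (A + B) ≤ N A + N B)
    (hUI : ∀ U V A : Matrix (Fin n) (Fin n) ℂ, U ∈ Matrix.unitaryGroup (Fin n) ℂ →
      V ∈ Matrix.unitaryGroup (Fin n) ℂ → N (U * A * V) = N A)
    (A : Matrix (Fin n) (Fin n) ℂ) : N (diagonal fun i => A i i) ≤ N A := by
  have key : ∀ s : Finset (Fin n),
      N (of fun i j => if i ≠ j ∧ (i ∈ s ∨ j ∈ s) then 0 else A i j) ≤ N A := by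
    intro s
    induction s using Finset.induction_on with
    | empty => simp; exact le_of_eq rfl
    | insert k s hk ih =>
      set B : Matrix (Fin n) (Fin n) ℂ :=
        of fun i j => if i ≠ j ∧ (i ∈ s ∨ j ∈ s) then 0 else A i j with hB
      have e : (of fun i j => if i ≠ j ∧ (i ∈ insert k s ∨ j ∈ insert k s) then 0 else A i j)
          = (1/2 : ℂ) • (B + auxD k * B * auxD k) := by
        ext i j
        simp only [auxD, diagonal_mul, mul_diagonal, Matrix.add_apply, Matrix.smul_apply, of_apply,
          hB, Finset.mem_insert, smul_eq_mul]
        by_cases h1 : i = k <;> by_cases h2 : j = k <;> by_cases h3 : i = j <;>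
          by_cases h4 : i ∈ s <;> by_cases h5 : j ∈ s <;> simp_all <;> ring
      rw [e, hNs]
      have := hNa B (auxD k * B * auxD k)
      rw [hUI _ _ _ (auxD_mem k) (auxD_mem k)] at this
      norm_num
      linarith
  have := key Finset.univ
  convert this using 2
  ext i j
  by_cases h : i = j <;> simp [h]

open Matrix in
theorem aux_diag {n : ℕ} {N : Matrix (Fin n) (Fin n) ℂ → ℝ}
    (hN0 : ∀ A : Matrix (Fin n) (Fin n) ℂ, N A = 0 ↔ A = 0)
    (hNs : ∀ (c : ℂ) (A : Matrix (Fin n) (Fin n) ℂ), N (c • A) = ‖c‖ * N A)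
    (hNa : ∀ A B : Matrix (Fin n) (Fin n) ℂ, N (A + B) ≤ N A + N B)
    (hUI : ∀ U V A : Matrix (Fin n) (Fin n) ℂ, U ∈ Matrix.unitaryGroup (Fin n) ℂ →
      V ∈ Matrix.unitaryGroup (Fin n) ℂ → N (U * A * V) = N A)
    (h q : Fin n → ℝ) (hq : ∀ i, |h i| ≤ q i) :
    N (diagonal fun i => (h i : ℂ)) ≤ N (diagonal fun i => (q i : ℂ)) := by
  have key : ∀ s : Finset (Fin n),
      N (diagonal fun i => ((if i ∈ s then h i else q i : ℝ) : ℂ)) ≤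
        N (diagonal fun i => (q i : ℂ)) := by
    intro s
    induction s using Finset.induction_on with
    | empty => simp
    | insert k s hk ih =>
      obtain ⟨t, ht, hth⟩ : ∃ t : ℝ, |t| ≤ 1 ∧ h k = t * q k := by
        by_cases h0 : q k = 0
        · refine ⟨0, by simp, ?_⟩
          have := hq k
          rw [h0] at this
          simpa using this
        · have hp : 0 < q k := lt_of_le_of_ne ((abs_nonneg _).trans (hq k)) (Ne.symm h0)
          refine ⟨h k / q k, ?_, by field_simp⟩
          rw [abs_div, abs_of_pos hp, div_le_one hp]
          exact hq k
      rw [abs_le] at ht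
      set B : Matrix (Fin n) (Fin n) ℂ :=
        diagonal fun i => ((if i ∈ s then h i else q i : ℝ) : ℂ) with hB
      have e : (diagonal fun i => ((if i ∈ insert k s then h i else q i : ℝ) : ℂ))
          = (((1 + t)/2 : ℝ) : ℂ) • B + (((1 - t)/2 : ℝ) : ℂ) • (auxD k * B * 1) := by
        rw [hB, auxD, mul_one, diagonal_mul_diagonal, ← diagonal_smul, ← diagonal_smul,
          diagonal_add]
        congr 1
        funext i
        by_cases h1 : i = k
        · subst h1
          simp [hk, hth]; ring
        · simp [h1]
          split_ifs <;> ring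
      rw [e]
      refine (hNa _ _).trans ?_
      rw [hNs, hNs, hUI _ _ _ (auxD_mem k) (one_mem _), Complex.norm_real, Complex.norm_real,
        Real.norm_of_nonneg (by linarith), Real.norm_of_nonneg (by linarith)]
      linarith
  simpa using key Finset.univ

open Matrix in
theorem aux_spec {n : ℕ} (H : Matrix (Fin n) (Fin n) ℂ) (hH : H.IsHermitian) :
    ∃ U ∈ Matrix.unitaryGroup (Fin n) ℂ, ∃ d : Fin n → ℝ,
      H = U * diagonal (fun i => (d i : ℂ)) * Uᴴ ∧ Uᴴ * H * U = diagonal (fun i => (d i : ℂ)) := by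
  have e := hH.spectral_theorem
  rw [Unitary.conjStarAlgAut_apply] at e
  have hU := hH.eigenvectorUnitary.2
  have h1 := Matrix.mem_unitaryGroup_iff'.1 hU
  rw [star_eq_conjTranspose] at h1
  set U : Matrix (Fin n) (Fin n) ℂ := ↑hH.eigenvectorUnitary
  refine ⟨U, hU, hH.eigenvalues, e, ?_⟩
  have e' : H = U * diagonal (fun i => (hH.eigenvalues i : ℂ)) * Uᴴ := e
  generalize diagonal (fun i => (hH.eigenvalues i : ℂ)) = D at e'
  rw [e', show Uᴴ * (U * D * Uᴴ) * U = (Uᴴ * U) * D * (Uᴴ * U) by simp only [mul_assoc], h1]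
  simp

open Matrix in
theorem aux_star_mem {n : ℕ} {U : Matrix (Fin n) (Fin n) ℂ}
    (hU : U ∈ Matrix.unitaryGroup (Fin n) ℂ) : Uᴴ ∈ Matrix.unitaryGroup (Fin n) ℂ := by
  rw [← star_eq_conjTranspose]; exact Unitary.star_mem hU

open Matrix in
theorem aux_mono {n : ℕ} {N : Matrix (Fin n) (Fin n) ℂ → ℝ}
    (hN0 : ∀ A : Matrix (Fin n) (Fin n) ℂ, N A = 0 ↔ A = 0)
    (hNs : ∀ (c : ℂ) (A : Matrix (Fin n) (Fin n) ℂ), N (c • A) = ‖c‖ * N A)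
    (hNa : ∀ A B : Matrix (Fin n) (Fin n) ℂ, N (A + B) ≤ N A + N B)
    (hUI : ∀ U V A : Matrix (Fin n) (Fin n) ℂ, U ∈ Matrix.unitaryGroup (Fin n) ℂ →
      V ∈ Matrix.unitaryGroup (Fin n) ℂ → N (U * A * V) = N A)
    (H Q : Matrix (Fin n) (Fin n) ℂ) (hH : H.IsHermitian)
    (h1 : (Q - H).PosSemidef) (h2 : (Q + H).PosSemidef) : N H ≤ N Q := by
  obtain ⟨U, hU, d, -, e⟩ := aux_spec H hH
  have g1 := h1.conjTranspose_mul_mul_same U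
  have g2 := h2.conjTranspose_mul_mul_same U
  rw [mul_sub, sub_mul, e] at g1
  rw [mul_add, add_mul, e] at g2
  rw [← hUI _ _ H (aux_star_mem hU) hU, ← hUI _ _ Q (aux_star_mem hU) hU, e]
  set R := Uᴴ * Q * U
  refine le_trans ?_ (aux_pinch hNs hNa hUI R)
  have a1 : ∀ i, 0 ≤ R i i - d i := fun i => by
    simpa using g1.diag_nonneg (i := i)
  have a2 : ∀ i, 0 ≤ R i i + d i := fun i => by
    simpa using g2.diag_nonneg (i := i)
  have a3 : (fun i => R i i) = fun i => (((R i i).re : ℝ) : ℂ) := by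
    funext i
    have := (Complex.le_def.1 (a1 i)).2
    apply Complex.ext <;> simp
    simpa using this.symm
  rw [a3]
  apply aux_diag hN0 hNs hNa hUI
  intro i
  have b1 := (Complex.le_def.1 (a1 i)).1
  have b2 := (Complex.le_def.1 (a2 i)).1
  simp at b1 b2
  rw [abs_le]; constructor <;> linarith

open Matrix in
theorem aux_spec_le {n : ℕ} {N : Matrix (Fin n) (Fin n) ℂ → ℝ}
    (hN0 : ∀ A : Matrix (Fin n) (Fin n) ℂ, N A = 0 ↔ A = 0)
    (hNs : ∀ (c : ℂ) (A : Matrix (Fin n) (Fin n) ℂ), N (c • A) = ‖c‖ * N A)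
    (hNa : ∀ A B : Matrix (Fin n) (Fin n) ℂ, N (A + B) ≤ N A + N B)
    (hUI : ∀ U V A : Matrix (Fin n) (Fin n) ℂ, U ∈ Matrix.unitaryGroup (Fin n) ℂ →
      V ∈ Matrix.unitaryGroup (Fin n) ℂ → N (U * A * V) = N A)
    (hSM : ∀ A B : Matrix (Fin n) (Fin n) ℂ, N (A * B) ≤ N A * N B)
    (P : Matrix (Fin n) (Fin n) ℂ) (hP : P.IsHermitian) :
    (((N P : ℝ) : ℂ) • (1 : Matrix (Fin n) (Fin n) ℂ) - P).PosSemidef := by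
  obtain ⟨U, hU, d, e1, e⟩ := aux_spec P hP
  have hd : ∀ i, d i ≤ N P := by
    intro i
    have hE : 0 < N (single i i (1 : ℂ)) := by
      refine lt_of_le_of_ne (aux_nonneg hN0 hNs hNa _) fun h => ?_
      have := (hN0 _).1 h.symm
      have := congrFun (congrFun this i) i
      simp at this
    have h1 := hSM (Uᴴ * P * U) (single i i (1 : ℂ))
    rw [hUI _ _ P (aux_star_mem hU) hU, e] at h1
    have h2 : diagonal (fun i => (d i : ℂ)) * single i i (1 : ℂ) = (d i : ℂ) • single i i (1 : ℂ) := by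
      ext a b
      rw [diagonal_mul]
      by_cases h : i = a
      · subst h; simp
      · simp [h]
    rw [h2, hNs, Complex.norm_real] at h1
    exact (le_abs_self _).trans (le_of_mul_le_mul_right h1 hE)
  have h1 := Matrix.mem_unitaryGroup_iff.1 hU
  rw [star_eq_conjTranspose] at h1
  have : ((N P : ℝ) : ℂ) • (1 : Matrix (Fin n) (Fin n) ℂ) - P
      = U * diagonal (fun i => ((N P - d i : ℝ) : ℂ)) * Uᴴ := by
    have e2 : diagonal (fun i => ((N P - d i : ℝ) : ℂ))
        = ((N P : ℝ) : ℂ) • (1 : Matrix (Fin n) (Fin n) ℂ) - diagonal (fun i => (d i : ℂ)) := by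
      ext a b
      by_cases h : a = b
      · subst h; simp
      · simp [h]
    rw [e2, mul_sub, sub_mul, ← e1]
    simp [h1]
  rw [this]
  apply PosSemidef.mul_mul_conjTranspose_same
  apply PosSemidef.diagonal
  intro i
  simpa using hd i

open Matrix in
theorem aux_had {n : ℕ} {N : Matrix (Fin n) (Fin n) ℂ → ℝ}
    (hN0 : ∀ A : Matrix (Fin n) (Fin n) ℂ, N A = 0 ↔ A = 0)
    (hNs : ∀ (c : ℂ) (A : Matrix (Fin n) (Fin n) ℂ), N (c • A) = ‖c‖ * N A)
    (hNa : ∀ A B : Matrix (Fin n) (Fin n) ℂ, N (A + B) ≤ N A + N B)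
    (hUI : ∀ U V A : Matrix (Fin n) (Fin n) ℂ, U ∈ Matrix.unitaryGroup (Fin n) ℂ →
      V ∈ Matrix.unitaryGroup (Fin n) ℂ → N (U * A * V) = N A)
    (hSM : ∀ A B : Matrix (Fin n) (Fin n) ℂ, N (A * B) ≤ N A * N B)
    (P R : Matrix (Fin n) (Fin n) ℂ) (hP : P.PosSemidef) (hR : R.PosSemidef) :
    N (P ⊙ R) ≤ N P * N R := by
  have h1 := (aux_spec_le hN0 hNs hNa hUI hSM P hP.1).hadamard hR
  have h0 := hP.hadamard hR
  have e : (((N P : ℝ) : ℂ) • (1 : Matrix (Fin n) (Fin n) ℂ) - P) ⊙ R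
      = ((N P : ℝ) : ℂ) • diagonal (fun i => R i i) - P ⊙ R := by
    ext a b
    by_cases h : a = b
    · subst h; simp [sub_mul]
    · simp [h]
  rw [e] at h1
  have h2 : N (P ⊙ R) ≤ N (((N P : ℝ) : ℂ) • diagonal (fun i => R i i)) := by
    apply aux_mono hN0 hNs hNa hUI _ _ h0.1 h1
    have := (h1.add h0).add h0
    simpa using this
  refine h2.trans ?_
  rw [hNs, Complex.norm_real, Real.norm_of_nonneg (aux_nonneg hN0 hNs hNa _)]
  exact mul_le_mul_of_nonneg_left (aux_pinch hNs hNa hUI R) (aux_nonneg hN0 hNs hNa _)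

open Matrix in
theorem aux_prod {n : ℕ} {N : Matrix (Fin n) (Fin n) ℂ → ℝ}
    (hN0 : ∀ A : Matrix (Fin n) (Fin n) ℂ, N A = 0 ↔ A = 0)
    (hNs : ∀ (c : ℂ) (A : Matrix (Fin n) (Fin n) ℂ), N (c • A) = ‖c‖ * N A)
    (hNa : ∀ A B : Matrix (Fin n) (Fin n) ℂ, N (A + B) ≤ N A + N B)
    (hUI : ∀ U V A : Matrix (Fin n) (Fin n) ℂ, U ∈ Matrix.unitaryGroup (Fin n) ℂ →
      V ∈ Matrix.unitaryGroup (Fin n) ℂ → N (U * A * V) = N A)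
    (hSM : ∀ A B : Matrix (Fin n) (Fin n) ℂ, N (A * B) ≤ N A * N B)
    {m : ℕ} (P : Fin m → Matrix (Fin n) (Fin n) ℂ) (hP : ∀ j, (P j).PosSemidef)
    (s : Finset (Fin m)) (hs : s.Nonempty) :
    (of fun i k => ∏ j ∈ s, P j i k).PosSemidef ∧
    N (of fun i k => ∏ j ∈ s, P j i k) ≤ ∏ j ∈ s, N (P j) := by
  induction hs using Finset.Nonempty.cons_induction with
  | singleton a => 
    have : (of fun i k => ∏ j ∈ {a}, P j i k) = P a := by ext; simp [-Finset.cons_eq_insert]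
    rw [this]; simp [hP a]
  | cons a s ha hs ih =>
    have : (of fun i k => ∏ j ∈ Finset.cons a s ha, P j i k)
        = P a ⊙ (of fun i k => ∏ j ∈ s, P j i k) := by ext; simp [-Finset.cons_eq_insert]
    rw [this, Finset.prod_cons]
    exact ⟨(hP a).hadamard ih.1, (aux_had hN0 hNs hNa hUI hSM _ _ (hP a) ih.1).trans
      (mul_le_mul_of_nonneg_left ih.2 (aux_nonneg hN0 hNs hNa _))⟩

open Matrix in
theorem aux_prod_psd {ι : Type*} [Fintype ι] [DecidableEq ι] 
    {m : ℕ} (P : Fin m → Matrix ι ι ℂ) (hP : ∀ j, (P j).PosSemidef)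
    (s : Finset (Fin m)) (hs : s.Nonempty) :
    (of fun i k => ∏ j ∈ s, P j i k).PosSemidef := by
  induction hs using Finset.Nonempty.cons_induction with
  | singleton a => 
    have : (of fun i k => ∏ j ∈ {a}, P j i k) = P a := by ext; simp [-Finset.cons_eq_insert]
    rw [this]; simp [hP a]
  | cons a s ha hs ih =>
    have : (of fun i k => ∏ j ∈ Finset.cons a s ha, P j i k)
        = P a ⊙ (of fun i k => ∏ j ∈ s, P j i k) := by ext; simp [-Finset.cons_eq_insert]
    rw [this]
    exact (hP a).hadamard ih

open Matrix in
theorem aux_block {n : ℕ} (X : Matrix (Fin n) (Fin n) ℂ)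
    (hA : (matRe X).PosSemidef) (hB : (matIm X).PosSemidef) :
    (fromBlocks (matRe X + matIm X) X Xᴴ (matRe X + matIm X)).PosSemidef := by
  have h1 := hA.conjTranspose_mul_mul_same (fromCols (1 : Matrix (Fin n) (Fin n) ℂ) (1 : Matrix (Fin n) (Fin n) ℂ))
  have h2 := hB.conjTranspose_mul_mul_same
    (fromCols (1 : Matrix (Fin n) (Fin n) ℂ) (Complex.I • (1 : Matrix (Fin n) (Fin n) ℂ)))
  have h := h1.add h2
  convert h using 1
  have hX : X = matRe X + Complex.I • matIm X := by
    ext i j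
    simp [matRe, matIm]
    field_simp
    ring_nf
    rw [Complex.I_sq]
    ring
  have hXs : Xᴴ = matRe X - Complex.I • matIm X := by
    ext i j
    simp [matRe, matIm]
    field_simp
    ring_nf
    rw [Complex.I_sq]
    ring
  rw [conjTranspose_fromCols_eq_fromRows_conjTranspose, conjTranspose_fromCols_eq_fromRows_conjTranspose,
    fromRows_mul _ _ (matRe X), fromRows_mul _ _ (matIm X), fromRows_mul_fromCols, fromRows_mul_fromCols, fromBlocks_add]
  have e : (Complex.I • (1 : Matrix (Fin n) (Fin n) ℂ))ᴴ = (-Complex.I) • 1 := by simp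
  rw [e]
  congr 1
  · simp
  · simpa using hX
  · simpa [sub_eq_add_neg] using hXs
  · simp [smul_smul]

open Matrix in
theorem aux_re {n : ℕ} (Q Y : Matrix (Fin n) (Fin n) ℂ)
    (h : (fromBlocks Q Y Yᴴ Q).PosSemidef) (c : ℂ) (hc : ‖c‖ = 1) :
    (Q + matRe (c • Y)).PosSemidef := by
  have h1 := h.conjTranspose_mul_mul_same (fromRows 1 (c • (1 : Matrix (Fin n) (Fin n) ℂ)))
  have h2 := h1.smul (show (0 : ℂ) ≤ 1/2 by 
    rw [show (1/2 : ℂ) = ((1/2 : ℝ) : ℂ) by simp]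
    exact_mod_cast (by norm_num : (0:ℝ) ≤ 1/2))
  convert h2 using 1
  have hcc : star c * c = 1 := by
    have := Complex.normSq_eq_conj_mul_self (z := c)
    rw [Complex.normSq_eq_norm_sq, hc] at this
    simpa using this.symm
  rw [conjTranspose_fromRows_eq_fromCols_conjTranspose, fromCols_mul_fromBlocks,
    fromCols_mul_fromRows]
  simp only [conjTranspose_one, one_mul, conjTranspose_smul, Matrix.mul_smul, Matrix.smul_mul, mul_one,
    matRe, smul_add, add_mul, Matrix.add_mul]
  rw [smul_smul c (star c), mul_comm c, hcc]
  module

open Matrix in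
theorem aux_gnr {n : ℕ} {N : Matrix (Fin n) (Fin n) ℂ → ℝ}
    (hNs : ∀ (c : ℂ) (A : Matrix (Fin n) (Fin n) ℂ), N (c • A) = ‖c‖ * N A)
    (hNa : ∀ A B : Matrix (Fin n) (Fin n) ℂ, N (A + B) ≤ N A + N B)
    (X : Matrix (Fin n) (Fin n) ℂ) :
    N (matRe X + matIm X) ≤ Real.sqrt 2 * gnr N X := by
  have hb : BddAbove (Set.range fun θ : ℝ => N (matRe (Complex.exp (θ * Complex.I) • X))) := by
    refine ⟨1/2 * (N X + N Xᴴ), ?_⟩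
    rintro _ ⟨θ, rfl⟩
    have h0 : ‖Complex.exp (θ * Complex.I)‖ = 1 := Complex.norm_exp_ofReal_mul_I θ
    have := hNa (Complex.exp (θ * Complex.I) • X) (star (Complex.exp (θ * Complex.I)) • Xᴴ)
    rw [hNs, hNs, norm_star, h0] at this
    simp only [matRe]
    rw [hNs, conjTranspose_smul]
    norm_num at this ⊢
    linarith
  have h1 := le_ciSup hb (-(Real.pi / 4))
  have hs : (0:ℝ) < Real.sqrt 2 := by positivity
  have e : matRe X + matIm X = ((Real.sqrt 2 : ℝ) : ℂ) •
      matRe (Complex.exp (((-(Real.pi / 4) : ℝ) : ℂ) * Complex.I) • X) := by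
    have h2 : Complex.exp (((-(Real.pi / 4) : ℝ) : ℂ) * Complex.I)
        = ((Real.sqrt 2 / 2 : ℝ) : ℂ) * (1 - Complex.I) := by
      rw [Complex.exp_mul_I, ← Complex.ofReal_cos, ← Complex.ofReal_sin, Real.cos_neg,
        Real.sin_neg, Real.cos_pi_div_four, Real.sin_pi_div_four]
      push_cast; ring
    have h3 : ((Real.sqrt 2 : ℝ) : ℂ) * ((Real.sqrt 2 : ℝ) : ℂ) = 2 := by
      rw [← Complex.ofReal_mul, Real.mul_self_sqrt (by norm_num)]; simp
    rw [h2]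
    ext i j
    have hI : (1 / (2 * Complex.I)) = -Complex.I / 2 := by
      rw [one_div, mul_inv, Complex.inv_I]; ring
    simp only [matRe, matIm, hI, Matrix.add_apply, Matrix.smul_apply, Matrix.sub_apply,
      conjTranspose_apply, smul_eq_mul, star_mul', RCLike.star_def, map_sub, map_one,
      Complex.conj_I, Complex.conj_ofReal]
    push_cast
    linear_combination (-(1/4) * ((1 - Complex.I) * X i j +
      (1 + Complex.I) * (starRingEnd ℂ) (X j i))) * h3
  rw [e, hNs, Complex.norm_real, Real.norm_of_nonneg hs.le]
  exact mul_le_mul_of_nonneg_left h1 hs.le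

theorem stmt_13 {n : ℕ} (N : Matrix (Fin n) (Fin n) ℂ → ℝ)
    (hN0 : ∀ A : Matrix (Fin n) (Fin n) ℂ, N A = 0 ↔ A = 0)
    (hNs : ∀ (c : ℂ) (A : Matrix (Fin n) (Fin n) ℂ), N (c • A) = ‖c‖ * N A)
    (hNa : ∀ A B : Matrix (Fin n) (Fin n) ℂ, N (A + B) ≤ N A + N B)
    (hUI : ∀ U V A : Matrix (Fin n) (Fin n) ℂ, U ∈ Matrix.unitaryGroup (Fin n) ℂ →
      V ∈ Matrix.unitaryGroup (Fin n) ℂ → N (U * A * V) = N A)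
    (hSM : ∀ A B : Matrix (Fin n) (Fin n) ℂ, N (A * B) ≤ N A * N B)
    {m : ℕ} (hm : 1 ≤ m)
    (X : Fin m → Matrix (Fin n) (Fin n) ℂ)
    (hX : ∀ j, (matRe (X j)).PosDef ∧ (matIm (X j)).PosDef) :
    gnr N (Matrix.of fun i k => ∏ j, X j i k) ≤
      (2 : ℝ) ^ ((m : ℝ) / 2) * ∏ j, gnr N (X j) := by
  have hne : (Finset.univ : Finset (Fin m)).Nonempty := ⟨⟨0, hm⟩, Finset.mem_univ _⟩
  set P : Fin m → Matrix (Fin n) (Fin n) ℂ := fun j => matRe (X j) + matIm (X j) with hPdef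
  have hP : ∀ j, (P j).PosSemidef := fun j => (hX j).1.posSemidef.add (hX j).2.posSemidef
  obtain ⟨-, hQ⟩ := aux_prod hN0 hNs hNa hUI hSM P hP Finset.univ hne
  have hF := aux_prod_psd (fun j => Matrix.fromBlocks (P j) (X j) (X j)ᴴ (P j))
    (fun j => aux_block (X j) (hX j).1.posSemidef (hX j).2.posSemidef) Finset.univ hne
  set Q : Matrix (Fin n) (Fin n) ℂ := Matrix.of fun i k => ∏ j, P j i k with hQdef
  set Y : Matrix (Fin n) (Fin n) ℂ := Matrix.of fun i k => ∏ j, X j i k with hYdef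
  have hF' : (Matrix.fromBlocks Q Y Yᴴ Q).PosSemidef := by
    convert hF using 1
    ext i k
    rcases i with i | i <;> rcases k with k | k <;> simp [hQdef, hYdef]
  have hY : gnr N Y ≤ N Q := by
    refine ciSup_le fun θ => ?_
    have hc : ‖Complex.exp (θ * Complex.I)‖ = 1 := Complex.norm_exp_ofReal_mul_I θ
    refine aux_mono hN0 hNs hNa hUI _ _ ?_ ?_ (aux_re Q Y hF' _ hc)
    · ext i j
      simp [matRe, add_comm]
      ring
    · have := aux_re Q Y hF' (-Complex.exp (θ * Complex.I)) (by rw [norm_neg, hc])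
      convert this using 1
      ext i j
      simp [matRe]
      ring
  refine hY.trans (hQ.trans ?_)
  have : ∏ j, N (P j) ≤ ∏ j, (Real.sqrt 2 * gnr N (X j)) :=
    Finset.prod_le_prod (fun j _ => aux_nonneg hN0 hNs hNa _)
      (fun j _ => aux_gnr hNs hNa (X j))
  refine this.trans (le_of_eq ?_)
  rw [Finset.prod_mul_distrib, Finset.prod_const, Finset.card_univ, Fintype.card_fin,
    Real.sqrt_eq_rpow, ← Real.rpow_natCast, ← Real.rpow_mul (by norm_num)]
  congr 2
  ring
end

section
/- Let N be a submultiplicative, unitarily invariant norm on the n×n complex matrices and let α₁, α₂ ∈ [0, π/2). If X ∈ M_n has numerical range W(X) ⊆ S_{α₁} and Y ∈ M_n has numerical range W(Y) ⊆ S_{α₂}, then ω_N(X ∘ Y) ≤ min{ (1 + tan α₁)·ω_N(Re(X))·ω_N(Y), (1 + tan α₂)·ω_N(X)·ω_N(Re(Y)) }; consequently ω_N(X ∘ Y) ≤ (1 + tan α)·ω_N(X)·ω_N(Y), where α = max{α₁, α₂}. -/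
open scoped ComplexOrder Matrix

structure NN {n : ℕ} (N : Matrix (Fin n) (Fin n) ℂ → ℝ) : Prop where
    hN0 : ∀ A : Matrix (Fin n) (Fin n) ℂ, N A = 0 ↔ A = 0
    hNs : ∀ (c : ℂ) (A : Matrix (Fin n) (Fin n) ℂ), N (c • A) = ‖c‖ * N A
    hNa : ∀ A B : Matrix (Fin n) (Fin n) ℂ, N (A + B) ≤ N A + N B
    hUI : ∀ U V A : Matrix (Fin n) (Fin n) ℂ, U ∈ Matrix.unitaryGroup (Fin n) ℂ →
      V ∈ Matrix.unitaryGroup (Fin n) ℂ → N (U * A * V) = N A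
    hSM : ∀ A B : Matrix (Fin n) (Fin n) ℂ, N (A * B) ≤ N A * N B

namespace NN
variable {n : ℕ} {N : Matrix (Fin n) (Fin n) ℂ → ℝ}

lemma zero (h : NN N) : N 0 = 0 := (h.hN0 0).2 rfl

lemma nonneg (h : NN N) (A : Matrix (Fin n) (Fin n) ℂ) : 0 ≤ N A := by
  have h1 := h.hNa A ((-1 : ℂ) • A)
  rw [h.hNs] at h1
  simp [h.zero] at h1
  exact h1

lemma UL (h : NN N) {U : Matrix (Fin n) (Fin n) ℂ} (hU : U ∈ Matrix.unitaryGroup (Fin n) ℂ)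
    (A : Matrix (Fin n) (Fin n) ℂ) : N (U * A) = N A := by
  have := h.hUI U 1 A hU (one_mem _)
  simpa using this

lemma UR (h : NN N) {U : Matrix (Fin n) (Fin n) ℂ} (hU : U ∈ Matrix.unitaryGroup (Fin n) ℂ)
    (A : Matrix (Fin n) (Fin n) ℂ) : N (A * U) = N A := by
  have := h.hUI 1 U A (one_mem _) hU
  simpa using this

lemma diag_unitary (d : Fin n → ℂ) (hd : ∀ i, ‖d i‖ = 1) :
    Matrix.diagonal d ∈ Matrix.unitaryGroup (Fin n) ℂ := by
  rw [Matrix.mem_unitaryGroup_iff, Matrix.star_eq_conjTranspose, Matrix.diagonal_conjTranspose,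
    Matrix.diagonal_mul_diagonal, ← Matrix.diagonal_one]
  congr 1
  funext i
  simp [Complex.mul_conj, Complex.normSq_eq_norm_sq, hd]

lemma diag_split (d : Fin n → ℝ) (hd : ∀ i, |d i| ≤ 1) :
    ∃ U V : Matrix (Fin n) (Fin n) ℂ, U ∈ Matrix.unitaryGroup (Fin n) ℂ ∧
      V ∈ Matrix.unitaryGroup (Fin n) ℂ ∧
      Matrix.diagonal (fun i => (d i : ℂ)) = (1 / 2 : ℂ) • (U + V) := by
  have hs : ∀ i, 0 ≤ 1 - d i ^ 2 := fun i => by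
    have := (sq_le_one_iff_abs_le_one (d i)).2 (hd i); linarith
  refine ⟨Matrix.diagonal fun i => (⟨d i, √(1 - d i ^ 2)⟩ : ℂ),
    Matrix.diagonal fun i => (⟨d i, -√(1 - d i ^ 2)⟩ : ℂ),
    diag_unitary _ fun i => ?_, diag_unitary _ fun i => ?_, ?_⟩
  · rw [← pow_eq_one_iff_of_nonneg (norm_nonneg _) two_ne_zero, ← Complex.normSq_eq_norm_sq, Complex.normSq_mk]
    have := Real.mul_self_sqrt (hs i)
    linarith
  · rw [← pow_eq_one_iff_of_nonneg (norm_nonneg _) two_ne_zero, ← Complex.normSq_eq_norm_sq, Complex.normSq_mk]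
    have := Real.mul_self_sqrt (hs i)
    linarith
  · rw [Matrix.diagonal_add, ← Matrix.diagonal_smul]
    congr 1
    funext i
    apply Complex.ext <;> simp
    ring

lemma contrL (h : NN N) (d : Fin n → ℝ) (hd : ∀ i, |d i| ≤ 1) (A : Matrix (Fin n) (Fin n) ℂ) :
    N (Matrix.diagonal (fun i => (d i : ℂ)) * A) ≤ N A := by
  obtain ⟨U, V, hU, hV, e⟩ := diag_split d hd
  rw [e, Matrix.smul_mul, h.hNs, Matrix.add_mul]
  have := h.hNa (U * A) (V * A)
  rw [h.UL hU, h.UL hV] at this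
  norm_num
  linarith

lemma contrR (h : NN N) (d : Fin n → ℝ) (hd : ∀ i, |d i| ≤ 1) (A : Matrix (Fin n) (Fin n) ℂ) :
    N (A * Matrix.diagonal (fun i => (d i : ℂ))) ≤ N A := by
  obtain ⟨U, V, hU, hV, e⟩ := diag_split d hd
  rw [e, Matrix.mul_smul, h.hNs, Matrix.mul_add]
  have := h.hNa (A * U) (A * V)
  rw [h.UR hU, h.UR hV] at this
  norm_num
  linarith

lemma diag_le (h : NN N) (A : Matrix (Fin n) (Fin n) ℂ) (p : Fin n) : ‖A p p‖ ≤ N A := by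
  set d : Fin n → ℝ := Pi.single p 1 with hd
  have hd1 : ∀ i, |d i| ≤ 1 := by
    intro i
    by_cases hi : i = p
    · subst hi; simp [hd]
    · simp [hd, hi]
  set E := Matrix.diagonal (fun i => (d i : ℂ)) with hE
  have hEE : E * E = E := by
    rw [hE, Matrix.diagonal_mul_diagonal]
    congr 1
    funext i
    by_cases hi : i = p
    · subst hi; simp [hd]
    · simp [hd, hi]
  have hne : N E ≠ 0 := by
    rw [ne_eq, h.hN0]
    intro h0
    have := congrFun (congrFun h0 p) p
    simp [hE, hd] at this
  have h1 : 1 ≤ N E := by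
    have h2 := h.hSM E E
    rw [hEE] at h2
    have h3 : 0 < N E := lt_of_le_of_ne (h.nonneg E) (Ne.symm hne)
    nlinarith
  have h2 : E * A * E = A p p • E := by
    ext i j
    rw [hE, Matrix.mul_diagonal, Matrix.diagonal_mul]
    by_cases hi : i = p
    · by_cases hj : j = p
      · subst hi; subst hj; simp [hd]
      · have : i ≠ j := by rintro rfl; exact hj hi
        simp [hd, hj, Matrix.diagonal_apply_ne _ this]
    · by_cases hij : i = j
      · subst hij; simp [hd, hi]
      · simp [hd, hi, Matrix.diagonal_apply_ne _ hij]
  have h3 : N (E * A * E) ≤ N A := (h.contrR d hd1 _).trans (h.contrL d hd1 _)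
  rw [h2, h.hNs] at h3
  nlinarith [norm_nonneg (A p p)]

/-- diagonal matrix with real entries -/
noncomputable def dg (t : Fin n → ℝ) : Matrix (Fin n) (Fin n) ℂ :=
  Matrix.diagonal (fun i => (t i : ℂ))

lemma dg_perm (h : NN N) (t : Fin n → ℝ) (σ : Equiv.Perm (Fin n)) :
    N (dg (fun i => t (σ i))) = N (dg t) := by
  have hp : σ.permMatrix ℂ ∈ Matrix.unitaryGroup (Fin n) ℂ := by
    rw [Matrix.mem_unitaryGroup_iff, Matrix.star_eq_conjTranspose, Matrix.conjTranspose_permMatrix,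
      ← Matrix.permMatrix_mul]
    simp
  have hp' : σ⁻¹.permMatrix ℂ ∈ Matrix.unitaryGroup (Fin n) ℂ := by
    rw [Matrix.mem_unitaryGroup_iff, Matrix.star_eq_conjTranspose, Matrix.conjTranspose_permMatrix,
      ← Matrix.permMatrix_mul]
    simp
  rw [← h.hUI _ _ (dg t) hp hp']
  congr 1
  ext i j
  simp [dg, Equiv.Perm.permMatrix, PEquiv.toMatrix_toPEquiv_mul, PEquiv.mul_toMatrix_toPEquiv,
    Matrix.diagonal_apply]
  have : (Equiv.symm σ⁻¹) j = σ j := rfl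
  simp [this]

lemma ds (h : NN N) (t : Fin n → ℝ) (ε : Fin n → Fin n → ℝ) (hε : ∀ i j, |ε i j| ≤ 1)
    (Q : Matrix (Fin n) (Fin n) ℝ) (hQ : Q ∈ doublyStochastic ℝ (Fin n)) :
    N (dg (fun i => ∑ j, ε i j * Q i j * t j)) ≤ N (dg t) := by
  have hQ' : Q ∈ (doublyStochastic ℝ (Fin n) : Set (Matrix (Fin n) (Fin n) ℝ)) := hQ
  rw [doublyStochastic_eq_convexHull_permMatrix] at hQ'
  let S : Set (Matrix (Fin n) (Fin n) ℝ) :=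
    {Q | N (dg (fun i => ∑ j, ε i j * Q i j * t j)) ≤ N (dg t)}
  suffices hh : convexHull ℝ {x | ∃ σ : Equiv.Perm (Fin n), σ.permMatrix ℝ = x} ⊆ S from hh hQ'
  apply convexHull_min
  · rintro _ ⟨σ, rfl⟩
    show N _ ≤ _
    rw [← h.dg_perm t σ]
    refine le_trans (le_of_eq ?_) (h.contrL (fun i => ε i (σ i)) (fun i => hε _ _) _)
    congr 1
    rw [dg, dg, Matrix.diagonal_mul_diagonal]
    congr 1
    funext i
    simp [Equiv.Perm.permMatrix, PEquiv.toMatrix_apply, Equiv.toPEquiv_apply]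
  · intro P hP R hR a b ha hb hab
    show N _ ≤ _
    have e : dg (fun i => ∑ j, ε i j * (a • P + b • R) i j * t j)
      = (a : ℂ) • dg (fun i => ∑ j, ε i j * P i j * t j)
        + (b : ℂ) • dg (fun i => ∑ j, ε i j * R i j * t j) := by
      rw [dg, dg, dg, ← Matrix.diagonal_smul, ← Matrix.diagonal_smul, Matrix.diagonal_add]
      congr 1
      funext i
      simp only [Pi.smul_apply, smul_eq_mul]
      rw [← Complex.ofReal_mul, ← Complex.ofReal_mul, ← Complex.ofReal_add, Finset.mul_sum,
        Finset.mul_sum, ← Finset.sum_add_distrib]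
      congr 1
      refine Finset.sum_congr rfl fun j _ => ?_
      simp only [Matrix.add_apply, Matrix.smul_apply, smul_eq_mul]
      ring
    rw [e]
    refine (h.hNa _ _).trans ?_
    rw [h.hNs, h.hNs, Complex.norm_real, Complex.norm_real, Real.norm_of_nonneg ha,
      Real.norm_of_nonneg hb]
    have h1 : N _ ≤ _ := hP
    have h2 : N _ ≤ _ := hR
    calc _ ≤ a * N (dg t) + b * N (dg t) := by gcongr
      _ = _ := by rw [← add_mul, hab, one_mul]

lemma exists_ds (P : Matrix (Fin n) (Fin n) ℝ) (h0 : ∀ i j, 0 ≤ P i j)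
    (hr : ∀ i, ∑ j, P i j ≤ 1) (hc : ∀ j, ∑ i, P i j ≤ 1) :
    ∃ Q ∈ doublyStochastic ℝ (Fin n), ∀ i j, P i j ≤ Q i j := by
  set r : Fin n → ℝ := fun i => 1 - ∑ j, P i j with hr'
  set c : Fin n → ℝ := fun j => 1 - ∑ i, P i j with hc'
  have r0 : ∀ i, 0 ≤ r i := fun i => by simp only [hr']; linarith [hr i]
  have c0 : ∀ i, 0 ≤ c i := fun i => by simp only [hc']; linarith [hc i]
  set S := ∑ i, r i with hS
  have hS' : S = ∑ j, c j := by
    simp only [hS, hr', hc', Finset.sum_sub_distrib]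
    rw [Finset.sum_comm]
  have S0 : 0 ≤ S := Finset.sum_nonneg fun i _ => r0 i
  have hR : ∀ i, r i * S / S = r i := by
    intro i
    by_cases hs : S = 0
    · have := (Finset.sum_eq_zero_iff_of_nonneg fun i _ => r0 i).1 (hS ▸ hs) i (Finset.mem_univ _)
      simp [hs, this]
    · field_simp
  have hC : ∀ i, S * c i / S = c i := by
    intro i
    by_cases hs : S = 0
    · have := (Finset.sum_eq_zero_iff_of_nonneg fun i _ => c0 i).1 (hS' ▸ hs) i (Finset.mem_univ _)
      simp [hs, this]
    · field_simp
  refine ⟨Matrix.of fun i j => P i j + r i * c j / S, ?_, ?_⟩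
  · rw [mem_doublyStochastic_iff_sum]
    refine ⟨fun i j => ?_, fun i => ?_, fun j => ?_⟩
    · have := h0 i j; have := r0 i; have := c0 j
      simp only [Matrix.of_apply]; positivity
    · simp only [Matrix.of_apply, Finset.sum_add_distrib]
      rw [← Finset.sum_div, ← Finset.mul_sum, ← hS', hR]
      simp [hr']
    · simp only [Matrix.of_apply, Finset.sum_add_distrib]
      rw [← Finset.sum_div, ← Finset.sum_mul, ← hS, hC]
      simp [hc']
  · intro i j
    have := r0 i; have := c0 j
    simp only [Matrix.of_apply, le_add_iff_nonneg_right]; positivity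

lemma substoch (h : NN N) (t : Fin n → ℝ) (c : ℝ) (hc0 : 0 < c) (P R : Fin n → Fin n → ℝ)
    (hPR : ∀ i j, |P i j| ≤ R i j) (hr : ∀ i, ∑ j, R i j ≤ c) (hc : ∀ j, ∑ i, R i j ≤ c) :
    N (dg (fun i => ∑ j, P i j * t j)) ≤ c * N (dg t) := by
  obtain ⟨Q, hQ, hle⟩ := exists_ds (Matrix.of fun i j => R i j / c)
    (fun i j => div_nonneg ((abs_nonneg _).trans (hPR i j)) hc0.le)
    (fun i => by simp only [Matrix.of_apply]; rw [← Finset.sum_div, div_le_one hc0]; exact hr i)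
    (fun i => by simp only [Matrix.of_apply]; rw [← Finset.sum_div, div_le_one hc0]; exact hc i)
  have h1 : ∀ i j, |P i j| ≤ c * Q i j := fun i j => by
    have := hle i j
    simp only [Matrix.of_apply] at this
    rw [div_le_iff₀ hc0] at this
    linarith [hPR i j]
  have h2 := h.ds t (fun i j => P i j / (c * Q i j)) (fun i j => by
    rw [abs_div]
    exact div_le_one_of_le₀ ((h1 i j).trans (le_abs_self _)) (abs_nonneg _)) Q hQ
  have e : dg (fun i => ∑ j, P i j * t j)
      = (c : ℂ) • dg (fun i => ∑ j, P i j / (c * Q i j) * Q i j * t j) := by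
    rw [dg, dg, ← Matrix.diagonal_smul]
    congr 1
    funext i
    simp only [Pi.smul_apply, smul_eq_mul]
    rw [← Complex.ofReal_mul, Finset.mul_sum]
    congr 1
    refine Finset.sum_congr rfl fun j _ => ?_
    by_cases hq : Q i j = 0
    · have := h1 i j
      rw [hq, mul_zero, abs_nonpos_iff] at this
      simp [this]
    · field_simp
  rw [e, h.hNs, Complex.norm_real, Real.norm_of_nonneg hc0.le]
  gcongr

/-- real quadratic form -/
noncomputable def qf (A : Matrix (Fin n) (Fin n) ℂ) (w : Fin n → ℂ) : ℝ :=
  (star w ⬝ᵥ A.mulVec w).re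

lemma qf_eq (A : Matrix (Fin n) (Fin n) ℂ) (w : Fin n → ℂ) :
    qf A w = (∑ p, ∑ q, star (w p) * A p q * w q).re := by
  simp only [qf, dotProduct, Matrix.mulVec, Finset.mul_sum, Pi.star_apply, mul_assoc]

lemma sum_row {W : Matrix (Fin n) (Fin n) ℂ} (hW : W ∈ Matrix.unitaryGroup (Fin n) ℂ)
    (p q : Fin n) : ∑ j, W p j * star (W q j) = if p = q then 1 else 0 := by
  have := congrFun (congrFun (Matrix.mem_unitaryGroup_iff.1 hW) p) q
  rw [Matrix.mul_apply, Matrix.one_apply] at this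
  exact this

lemma sum_col {W : Matrix (Fin n) (Fin n) ℂ} (hW : W ∈ Matrix.unitaryGroup (Fin n) ℂ)
    (i : Fin n) : ∑ p, ‖W p i‖ ^ 2 = 1 := by
  have := congrFun (congrFun (Matrix.mem_unitaryGroup_iff'.1 hW) i) i
  rw [Matrix.mul_apply, Matrix.one_apply, if_pos rfl] at this
  simp only [Matrix.star_apply] at this
  have h2 : ∀ p, star (W p i) * W p i = ((‖W p i‖ ^ 2 : ℝ) : ℂ) := fun p => by
    rw [mul_comm, ← Complex.normSq_eq_norm_sq]; exact Complex.mul_conj _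
  simp only [h2] at this
  exact_mod_cast this

lemma map_star_unitary {W : Matrix (Fin n) (Fin n) ℂ} (hW : W ∈ Matrix.unitaryGroup (Fin n) ℂ) :
    W.map star ∈ Matrix.unitaryGroup (Fin n) ℂ := by
  rw [Matrix.mem_unitaryGroup_iff]
  ext p q
  have := congrArg star (sum_row hW p q)
  rw [Matrix.mul_apply, Matrix.one_apply]
  rw [star_sum] at this
  simp only [star_mul', star_star] at this
  simp only [Matrix.star_apply, Matrix.map_apply, star_star]
  rw [this]
  split_ifs <;> simp

lemma sum_qf (A W : Matrix (Fin n) (Fin n) ℂ) (hW : W ∈ Matrix.unitaryGroup (Fin n) ℂ)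
    (u : Fin n → ℂ) (hu : ∑ p, ‖u p‖ ^ 2 = 1) (c : ℝ) (hc : ∀ p, ‖A p p‖ ≤ c) :
    ∑ j, qf A (fun p => u p * W p j) ≤ c := by
  have h1 : ∑ j, qf A (fun p => u p * W p j)
      = (∑ p, ∑ q, star (u p) * A p q * u q * ∑ j, W q j * star (W p j)).re := by
    simp only [qf_eq]
    rw [← Complex.re_sum, Finset.sum_comm]
    congr 1
    refine Finset.sum_congr rfl fun p _ => ?_
    rw [Finset.sum_comm]
    refine Finset.sum_congr rfl fun q _ => ?_
    rw [Finset.mul_sum]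
    refine Finset.sum_congr rfl fun j _ => ?_
    rw [star_mul']
    ring
  rw [h1]
  simp only [sum_row hW]
  simp only [mul_ite, mul_one, mul_zero, Finset.sum_ite_eq', Finset.mem_univ, if_true]
  rw [Complex.re_sum]
  calc _ ≤ ∑ p, ‖u p‖ ^ 2 * c := by
        refine Finset.sum_le_sum fun p _ => (Complex.re_le_norm _).trans ?_
        rw [norm_mul, norm_mul, norm_star]
        have := hc p
        calc _ = ‖u p‖ ^ 2 * ‖A p p‖ := by ring
          _ ≤ _ := by gcongr
    _ = c := by rw [← Finset.sum_mul, hu, one_mul]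

lemma spec {H : Matrix (Fin n) (Fin n) ℂ} (hH : H.IsHermitian) :
    ∃ V ∈ Matrix.unitaryGroup (Fin n) ℂ, ∃ t : Fin n → ℝ, H = V * dg t * star V := by
  refine ⟨hH.eigenvectorUnitary, hH.eigenvectorUnitary.2, hH.eigenvalues, ?_⟩
  have := hH.spectral_theorem
  rw [Unitary.conjStarAlgAut_apply] at this
  exact this

lemma key_pos (h : NN N) {A B H : Matrix (Fin n) (Fin n) ℂ} (hB : B.IsHermitian)
    (hH : H.IsHermitian) (t : ℝ) (ht : 0 ≤ t) (hAB : ∀ w, |qf B w| ≤ t * qf A w) (c : ℝ)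
    (hc : 0 < c) (hAc : t * N A ≤ c) :
    N (Matrix.hadamard B H) ≤ c * N H := by
  have hBH : (Matrix.hadamard B H).IsHermitian := by
    ext p q
    have h1 := congrFun (congrFun hB p) q
    have h2 := congrFun (congrFun hH p) q
    simp only [Matrix.conjTranspose_apply] at h1 h2
    simp only [Matrix.conjTranspose_apply, Matrix.hadamard_apply, star_mul', h1, h2]
  obtain ⟨V, hV, s, eH⟩ := spec hH
  obtain ⟨U, hU, m, eM⟩ := spec hBH
  have hUs : star U ∈ Matrix.unitaryGroup (Fin n) ℂ := Unitary.star_mem hU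
  have hVs : star V ∈ Matrix.unitaryGroup (Fin n) ℂ := Unitary.star_mem hV
  have e1 : N H = N (dg s) := by rw [eH, h.hUI _ _ _ hV hVs]
  have e2 : N (Matrix.hadamard B H) = N (dg m) := by rw [eM, h.hUI _ _ _ hU hUs]
  have e3 : dg m = star U * Matrix.hadamard B H * U := by
    rw [eM]
    have := Matrix.mem_unitaryGroup_iff'.1 hU
    calc dg m = 1 * dg m * 1 := by simp
      _ = (star U * U) * dg m * (star U * U) := by rw [this]
      _ = _ := by simp only [Matrix.mul_assoc]
  have hHe : ∀ p q, H p q = ∑ j, V p j * s j * star (V q j) := by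
    intro p q
    conv_lhs => rw [eH]
    rw [Matrix.mul_apply]
    refine Finset.sum_congr rfl fun j _ => ?_
    rw [dg, Matrix.mul_diagonal]; rfl
  have hm : ∀ i, m i = ∑ j, qf B (fun p => U p i * (V.map star) p j) * s j := by
    intro i
    have h1 : (m i : ℂ) = (star U * Matrix.hadamard B H * U) i i := by
      rw [← e3]; simp [dg]
    have h2 : m i = ((star U * Matrix.hadamard B H * U) i i).re := by
      rw [← h1, Complex.ofReal_re]
    rw [h2]
    simp only [qf_eq, ← Complex.re_mul_ofReal]
    rw [← Complex.re_sum]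
    congr 1
    simp only [Matrix.mul_apply, Matrix.hadamard_apply, Finset.sum_mul, hHe, Finset.mul_sum,
      Matrix.star_apply, Matrix.map_apply, star_mul', star_star]
    rw [Finset.sum_comm]
    conv_lhs =>
      enter [2, p]
      rw [Finset.sum_comm]
    rw [Finset.sum_comm]
    refine Finset.sum_congr rfl fun j _ => ?_
    refine Finset.sum_congr rfl fun p _ => ?_
    refine Finset.sum_congr rfl fun q _ => ?_
    ring
  rw [e1, e2]
  have hd := h.diag_le A
  have hVm := map_star_unitary hV
  have h5 := h.substoch s c hc (fun i j => qf B (fun p => U p i * (V.map star) p j))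
    (fun i j => t * qf A (fun p => U p i * (V.map star) p j)) (fun i j => hAB _)
    (fun i => by
      rw [← Finset.mul_sum]
      refine le_trans ?_ hAc
      gcongr
      exact sum_qf A _ hVm _ (sum_col hU i) _ hd)
    (fun j => by
      rw [← Finset.mul_sum]
      refine le_trans ?_ hAc
      gcongr
      have := sum_qf A _ hU _ (sum_col hVm j) _ hd
      simpa only [mul_comm] using this)
  have : m = fun i => ∑ j, qf B (fun p => U p i * (V.map star) p j) * s j := funext hm
  rw [this]
  exact h5

lemma key (h : NN N) {A B H : Matrix (Fin n) (Fin n) ℂ} (hB : B.IsHermitian)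
    (hH : H.IsHermitian) (t : ℝ) (ht : 0 ≤ t) (hAB : ∀ w, |qf B w| ≤ t * qf A w) :
    N (Matrix.hadamard B H) ≤ t * N A * N H := by
  have hA := h.nonneg A
  have h1 : ∀ ε : ℝ, 0 < ε → N (Matrix.hadamard B H) ≤ (t * N A + ε) * N H := fun ε hε =>
    h.key_pos hB hH t ht hAB _ (by positivity) (by linarith)
  have h2 : Filter.Tendsto (fun ε : ℝ => (t * N A + ε) * N H) (nhdsWithin 0 (Set.Ioi 0))
      (nhds ((t * N A + 0) * N H)) := by
    apply Filter.Tendsto.mono_left _ nhdsWithin_le_nhds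
    exact Continuous.tendsto (by fun_prop) 0
  rw [add_zero] at h2
  exact ge_of_tendsto h2 (Filter.eventually_of_mem self_mem_nhdsWithin fun ε hε => h1 ε hε)

lemma matRe_herm (X : Matrix (Fin n) (Fin n) ℂ) : (matRe X).IsHermitian := by
  ext p q
  simp [matRe, Matrix.conjTranspose_apply, add_comm]
  ring

lemma matIm_herm (X : Matrix (Fin n) (Fin n) ℂ) : (matIm X).IsHermitian := by
  ext p q
  simp [matIm, Matrix.conjTranspose_apply]
  ring

lemma bdd (h : NN N) (X : Matrix (Fin n) (Fin n) ℂ) :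
    BddAbove (Set.range fun θ : ℝ => N (matRe (Complex.exp (θ * Complex.I) • X))) := by
  refine ⟨1 / 2 * (N X + N Xᴴ), ?_⟩
  rintro _ ⟨θ, rfl⟩
  simp only [matRe]
  rw [h.hNs, Matrix.conjTranspose_smul]
  have := h.hNa (Complex.exp (θ * Complex.I) • X) (star (Complex.exp (θ * Complex.I)) • Xᴴ)
  rw [h.hNs, h.hNs, norm_star, Complex.norm_exp_ofReal_mul_I, one_mul, one_mul] at this
  have e : ‖(1 / 2 : ℂ)‖ = 1 / 2 := by norm_num
  rw [e]
  gcongr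

lemma le_gnr (h : NN N) (X : Matrix (Fin n) (Fin n) ℂ) (θ : ℝ) :
    N (matRe (Complex.exp (θ * Complex.I) • X)) ≤ gnr N X :=
  le_ciSup (h.bdd X) θ

lemma gnr_nonneg (h : NN N) (X : Matrix (Fin n) (Fin n) ℂ) : 0 ≤ gnr N X :=
  (h.nonneg _).trans (h.le_gnr X 0)

lemma re_le_gnr (h : NN N) (X : Matrix (Fin n) (Fin n) ℂ) : N (matRe X) ≤ gnr N X := by
  simpa using h.le_gnr X 0

lemma matRe_of_herm {X : Matrix (Fin n) (Fin n) ℂ} (hX : X.IsHermitian) : matRe X = X := by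
  have hX' : Xᴴ = X := hX
  ext p q
  simp [matRe, hX']
  ring

lemma gnr_re_le (h : NN N) (X : Matrix (Fin n) (Fin n) ℂ) : gnr N (matRe X) ≤ gnr N X := by
  refine ciSup_le fun θ => ?_
  refine le_trans ?_ (h.re_le_gnr X)
  have hA : (matRe X)ᴴ = matRe X := matRe_herm X
  set A := matRe X
  have h0 := h.nonneg A
  have h1 := h.hNa (Complex.exp (θ * Complex.I) • A) (star (Complex.exp (θ * Complex.I)) • A)
  rw [h.hNs, h.hNs, norm_star, Complex.norm_exp_ofReal_mul_I] at h1
  rw [matRe, h.hNs, Matrix.conjTranspose_smul, hA]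
  have e : ‖(1 / 2 : ℂ)‖ = 1 / 2 := by norm_num
  rw [e]
  linarith

lemma qf_smul (X : Matrix (Fin n) (Fin n) ℂ) (w : Fin n → ℂ) :
    star w ⬝ᵥ Xᴴ.mulVec w = star (star w ⬝ᵥ X.mulVec w) := by
  simp only [dotProduct, Matrix.mulVec, Finset.mul_sum, star_sum, Pi.star_apply, star_mul',
    star_star, Matrix.conjTranspose_apply]
  rw [Finset.sum_comm]
  refine Finset.sum_congr rfl fun p _ => Finset.sum_congr rfl fun q _ => ?_
  ring

lemma qf_re (X : Matrix (Fin n) (Fin n) ℂ) (w : Fin n → ℂ) :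
    qf (matRe X) w = (star w ⬝ᵥ X.mulVec w).re := by
  rw [qf, matRe, Matrix.smul_mulVec, Matrix.add_mulVec, dotProduct_smul, dotProduct_add, qf_smul]
  simp
  ring

lemma qf_im (X : Matrix (Fin n) (Fin n) ℂ) (w : Fin n → ℂ) :
    qf (matIm X) w = (star w ⬝ᵥ X.mulVec w).im := by
  rw [qf, matIm, Matrix.smul_mulVec, Matrix.sub_mulVec, dotProduct_smul, dotProduct_sub, qf_smul]
  simp
  ring

lemma sector_ineq {X : Matrix (Fin n) (Fin n) ℂ} {α : ℝ} (hX : numRange X ⊆ sector α)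
    (w : Fin n → ℂ) : 0 ≤ (star w ⬝ᵥ X.mulVec w).re ∧
      |(star w ⬝ᵥ X.mulVec w).im| ≤ Real.tan α * (star w ⬝ᵥ X.mulVec w).re := by
  by_cases hw : w = 0
  · simp [hw]
  have h1 : star w ⬝ᵥ w = ((∑ p, ‖w p‖ ^ 2 : ℝ) : ℂ) := by
    simp only [dotProduct, Pi.star_apply, Complex.ofReal_sum]
    refine Finset.sum_congr rfl fun p _ => ?_
    rw [mul_comm, ← Complex.normSq_eq_norm_sq]; exact Complex.mul_conj _
  set r := ∑ p, ‖w p‖ ^ 2 with hr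
  have r0 : 0 < r := by
    obtain ⟨p, hp⟩ := Function.ne_iff.1 hw
    exact Finset.sum_pos' (fun i _ => by positivity)
      ⟨p, Finset.mem_univ _, by have := norm_pos_iff.2 hp; positivity⟩
  set k : ℝ := (√r)⁻¹ with hk
  have k0 : 0 < k := by positivity
  have hkr : k * k * r = 1 := by
    have := Real.mul_self_sqrt r0.le
    have h3 : 0 < √r := by positivity
    rw [hk]; field_simp; nlinarith
  have hmem : ((k * k : ℝ) : ℂ) * (star w ⬝ᵥ X.mulVec w) ∈ numRange X := by
    refine ⟨(k : ℂ) • w, ?_, ?_⟩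
    · rw [star_smul, smul_dotProduct, dotProduct_smul, h1]
      simp only [smul_eq_mul, RCLike.star_def, Complex.conj_ofReal]
      rw [← mul_assoc]
      exact_mod_cast hkr
    · rw [star_smul, smul_dotProduct, Matrix.mulVec_smul, dotProduct_smul]
      simp only [smul_eq_mul, RCLike.star_def, Complex.conj_ofReal]
      push_cast; ring
  obtain ⟨h2, h3⟩ := hX hmem
  rw [Complex.re_ofReal_mul] at h2 h3
  rw [Complex.im_ofReal_mul, abs_mul, abs_of_pos (by positivity : 0 < k * k)] at h3
  have kk : 0 < k * k := by positivity
  refine ⟨((pos_iff_pos_of_mul_pos h2).1 kk).le, ?_⟩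
  refine le_of_mul_le_mul_left ?_ kk
  linarith

lemma re_had (X Z : Matrix (Fin n) (Fin n) ℂ) :
    matRe (Matrix.hadamard X Z) = Matrix.hadamard (matRe X) (matRe Z)
      + Matrix.hadamard (matIm X) (matRe (Complex.I • Z)) := by
  ext p q
  simp only [matRe, matIm, Matrix.smul_apply, Matrix.add_apply, Matrix.hadamard_apply,
    Matrix.conjTranspose_apply, Matrix.sub_apply, smul_eq_mul, star_mul', RCLike.star_def,
    Complex.conj_I]
  field_simp
  ring_nf
  try simp only [Complex.I_sq]
  try ring

lemma main (h : NN N) {α : ℝ} (hα0 : 0 ≤ α) (hα1 : α < Real.pi / 2)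
    (X Y : Matrix (Fin n) (Fin n) ℂ) (hX : numRange X ⊆ sector α) :
    gnr N (Matrix.hadamard X Y) ≤ (1 + Real.tan α) * gnr N (matRe X) * gnr N Y := by
  have ht : 0 ≤ Real.tan α := Real.tan_nonneg_of_nonneg_of_le_pi_div_two hα0 hα1.le
  refine ciSup_le fun θ => ?_
  have e : Complex.exp (θ * Complex.I) • Matrix.hadamard X Y
      = Matrix.hadamard X (Complex.exp (θ * Complex.I) • Y) := by
    rw [Matrix.hadamard_smul]
  rw [e, re_had]
  have e2 : Complex.I • Complex.exp (θ * Complex.I) • Y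
      = Complex.exp (((θ + Real.pi / 2 : ℝ) : ℂ) * Complex.I) • Y := by
    rw [smul_smul]
    congr 1
    push_cast
    rw [add_mul, Complex.exp_add, Complex.exp_pi_div_two_mul_I, mul_comm]
  have hA : N (matRe X) ≤ gnr N (matRe X) := by
    have := h.re_le_gnr (matRe X)
    rwa [matRe_of_herm (matRe_herm X)] at this
  have g0 := h.gnr_nonneg (matRe X)
  have n0 := h.nonneg (matRe X)
  have y0 := h.gnr_nonneg Y
  have h1 := h.key (A := matRe X) (matRe_herm X)
    (matRe_herm (Complex.exp (θ * Complex.I) • Y)) 1 zero_le_one (fun w => by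
      rw [one_mul, qf_re, abs_of_nonneg (sector_ineq hX w).1])
  have h2 := h.key (A := matRe X) (matIm_herm X)
    (matRe_herm (Complex.I • Complex.exp (θ * Complex.I) • Y)) (Real.tan α) ht (fun w => by
      rw [qf_re, qf_im]; exact (sector_ineq hX w).2)
  have h3 := h.le_gnr Y θ
  have h4 := h.le_gnr Y (θ + Real.pi / 2)
  rw [← e2] at h4
  calc _ ≤ _ := h.hNa _ _
    _ ≤ _ := add_le_add h1 h2
    _ ≤ 1 * gnr N (matRe X) * gnr N Y + Real.tan α * gnr N (matRe X) * gnr N Y := by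
      gcongr
      · exact h.nonneg _
      · exact h.nonneg _
    _ = _ := by ring

end NN

theorem stmt_18 {n : ℕ} (N : Matrix (Fin n) (Fin n) ℂ → ℝ)
    (hN0 : ∀ A : Matrix (Fin n) (Fin n) ℂ, N A = 0 ↔ A = 0)
    (hNs : ∀ (c : ℂ) (A : Matrix (Fin n) (Fin n) ℂ), N (c • A) = ‖c‖ * N A)
    (hNa : ∀ A B : Matrix (Fin n) (Fin n) ℂ, N (A + B) ≤ N A + N B)
    (hUI : ∀ U V A : Matrix (Fin n) (Fin n) ℂ, U ∈ Matrix.unitaryGroup (Fin n) ℂ →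
      V ∈ Matrix.unitaryGroup (Fin n) ℂ → N (U * A * V) = N A)
    (hSM : ∀ A B : Matrix (Fin n) (Fin n) ℂ, N (A * B) ≤ N A * N B)
    {α₁ α₂ : ℝ} (hα₁0 : 0 ≤ α₁) (hα₁1 : α₁ < Real.pi / 2)
    (hα₂0 : 0 ≤ α₂) (hα₂1 : α₂ < Real.pi / 2)
    (X Y : Matrix (Fin n) (Fin n) ℂ)
    (hX : numRange X ⊆ sector α₁) (hY : numRange Y ⊆ sector α₂) :
    gnr N (Matrix.hadamard X Y) ≤
        min ((1 + Real.tan α₁) * gnr N (matRe X) * gnr N Y)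
            ((1 + Real.tan α₂) * gnr N X * gnr N (matRe Y)) ∧
      gnr N (Matrix.hadamard X Y) ≤
        (1 + Real.tan (max α₁ α₂)) * gnr N X * gnr N Y := by
  have h : NN N := ⟨hN0, hNs, hNa, hUI, hSM⟩
  have h1 := h.main hα₁0 hα₁1 X Y hX
  have h2 := h.main hα₂0 hα₂1 Y X hY
  rw [Matrix.hadamard_comm] at h2
  refine ⟨le_min h1 (h2.trans (le_of_eq (by ring))), h1.trans ?_⟩
  have ht : 0 ≤ Real.tan α₁ := Real.tan_nonneg_of_nonneg_of_le_pi_div_two hα₁0 hα₁1.le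
  have hm : Real.tan α₁ ≤ Real.tan (max α₁ α₂) := by
    apply Real.strictMonoOn_tan.monotoneOn
    · exact ⟨by linarith [Real.pi_pos], hα₁1⟩
    · exact ⟨by linarith [Real.pi_pos, le_max_left α₁ α₂], max_lt hα₁1 hα₂1⟩
    · exact le_max_left _ _
  have y0 := h.gnr_nonneg Y
  have x0 := h.gnr_nonneg (matRe X)
  have hx := h.gnr_re_le X
  gcongr
  linarith
end
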